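/- arXiv:2408.06548 — 14 statements merged into one kernel-verified Lean document; each statement's English description precedes it below -/
import Mathlib

section
/- For continuous A, B : [t₀, t₀+τ] → Mat(n,ℝ) and each φ ∈ C([−τ,0], ℝⁿ) there is a unique solution x of the linear delay system with coefficients (A,B) and initial datum φ, and the map U_{A,B} : C([−τ,0], ℝⁿ) → C([−τ,0], ℝⁿ) sending φ to the segment θ ↦ x(t₀+τ+θ) is a bounded linear operator. Moreover, for every R > 0 there exists L > 0 (depending only on R, n and τ) such that whenever ‖A‖_{C⁰} ≤ R, ‖B‖_{C⁰} ≤ R and max(‖Ã−A‖_{C⁰}, ‖B̃−B‖_{C⁰}) ≤ 1, the operator norm of U_{A,B} − U_{Ã,B̃} on C([−τ,0], ℝⁿ) (with the sup norm) is at most L·(‖A−Ã‖_{L¹} + ‖B−B̃‖_{L¹}). -/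
/-- `x` is a solution of the linear delay system `x'(t) = A(t)x(t) + B(t)x(t−τ)` on
`[t₀, t₀+τ]` with initial datum `φ ∈ C([−τ,0], ℝⁿ)` (matrices are modelled as
continuous linear maps on `ℝⁿ` with the max norm). -/
def IsDelaySolution (n : ℕ) (τ t₀ : ℝ)
    (A B : ℝ → (Fin n → ℝ) →L[ℝ] (Fin n → ℝ))
    (φ : C(Set.Icc (-τ) (0 : ℝ), Fin n → ℝ)) (x : ℝ → Fin n → ℝ) : Prop :=
  ContinuousOn x (Set.Icc (t₀ - τ) (t₀ + τ)) ∧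
  (∀ θ : Set.Icc (-τ) (0 : ℝ), x (t₀ + (θ : ℝ)) = φ θ) ∧
  ∀ t ∈ Set.Icc t₀ (t₀ + τ),
    HasDerivWithinAt x (A t (x t) + B t (x (t - τ))) (Set.Icc t₀ (t₀ + τ)) t

/-- Coordinatewise truncation of a vector to the cube of half-side `r`. -/
def clampVec {n : ℕ} (r : ℝ) (x : Fin n → ℝ) : Fin n → ℝ := fun i => max (-r) (min r (x i))

lemma clampVec_lipschitz {n : ℕ} (r : ℝ) (x y : Fin n → ℝ) :
    ‖clampVec r x - clampVec r y‖ ≤ ‖x - y‖ := by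
  refine (pi_norm_le_iff_of_nonneg (norm_nonneg _)).2 fun i => ?_
  refine le_trans ?_ (norm_le_pi_norm (x - y) i)
  simp only [clampVec, Pi.sub_apply, Real.norm_eq_abs]
  exact (abs_max_sub_max_le_max _ _ _ _).trans
    (max_le (by simp) ((abs_min_sub_min_le_max _ _ _ _).trans (max_le (by simp) le_rfl)))

lemma clampVec_zero {n : ℕ} {r : ℝ} (hr : 0 ≤ r) : clampVec r (0 : Fin n → ℝ) = 0 := by
  ext i; simp [clampVec, hr]

lemma clampVec_norm_le {n : ℕ} {r : ℝ} (hr : 0 ≤ r) (x : Fin n → ℝ) :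
    ‖clampVec r x‖ ≤ ‖x‖ := by
  simpa [clampVec_zero hr] using clampVec_lipschitz r x 0

lemma clampVec_norm_le_radius {n : ℕ} {r : ℝ} (hr : 0 ≤ r) (x : Fin n → ℝ) :
    ‖clampVec r x‖ ≤ r := by
  refine (pi_norm_le_iff_of_nonneg hr).2 fun i => ?_
  simp only [clampVec, Real.norm_eq_abs]
  exact abs_le.2 ⟨le_max_left _ _, max_le (by linarith) (min_le_left _ _)⟩

lemma clampVec_eq {n : ℕ} {r : ℝ} (x : Fin n → ℝ) (hx : ‖x‖ ≤ r) : clampVec r x = x := by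
  ext i
  have h := abs_le.1 ((norm_le_pi_norm x i).trans hx)
  simp only [clampVec]
  rw [min_eq_right h.2, max_eq_right h.1]

/-- Groenwall's inequality for derivatives within a compact interval. -/
lemma gronwall_within {E : Type*} [NormedAddCommGroup E] [NormedSpace ℝ E]
    {f f' : ℝ → E} {δ K ε a b : ℝ} (hδ : 0 ≤ δ) (hK : 0 < K) (hε : 0 ≤ ε)
    (hf : ∀ t ∈ Set.Icc a b, HasDerivWithinAt f (f' t) (Set.Icc a b) t)
    (ha : ‖f a‖ ≤ δ) (bound : ∀ t ∈ Set.Icc a b, ‖f' t‖ ≤ K * ‖f t‖ + ε) :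
    ∀ t ∈ Set.Icc a b,
      ‖f t‖ ≤ δ * Real.exp (K * (b - a)) + ε / K * (Real.exp (K * (b - a)) - 1) := by
  intro t ht
  have h := norm_le_gronwallBound_of_norm_deriv_right_le (f := f) (f' := f') (δ := δ) (K := K)
    (ε := ε) (a := a) (b := b) (fun t ht => (hf t ht).continuousWithinAt)
    (fun t ht => ((hf t ⟨ht.1, ht.2.le⟩).mono_of_mem_nhdsWithin
      (Filter.mem_of_superset (Icc_mem_nhdsGE ht.2) (Set.Icc_subset_Icc_left ht.1)))) ha
    (fun t ht => bound t ⟨ht.1, ht.2.le⟩) t ht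
  refine h.trans ((gronwallBound_mono hδ hε hK.le (sub_le_sub_right ht.2 a)).trans ?_)
  rw [gronwallBound_of_K_ne_0 hK.ne']

lemma exists_bound {E : Type*} [NormedAddCommGroup E] {g : ℝ → E} {a b : ℝ}
    (hg : ContinuousOn g (Set.Icc a b)) : ∃ C : ℝ, 0 < C ∧ ∀ t ∈ Set.Icc a b, ‖g t‖ ≤ C := by
  obtain ⟨C, hC⟩ := isCompact_Icc.exists_bound_of_continuousOn hg
  exact ⟨max C 1, by positivity, fun t ht => (hC t ht).trans (le_max_left _ _)⟩

/-- Global existence for linear inhomogeneous ODEs. -/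
lemma linear_ode_exists {n : ℕ} {a b : ℝ} (hab : a ≤ b)
    {A : ℝ → (Fin n → ℝ) →L[ℝ] (Fin n → ℝ)} {g : ℝ → Fin n → ℝ}
    (hA : ContinuousOn A (Set.Icc a b)) (hg : ContinuousOn g (Set.Icc a b)) (c : Fin n → ℝ) :
    ∃ y : ℝ → Fin n → ℝ, y a = c ∧
      ∀ t ∈ Set.Icc a b, HasDerivWithinAt y (A t (y t) + g t) (Set.Icc a b) t := by
  obtain ⟨M, hM, hAM⟩ := exists_bound hA
  obtain ⟨G, hG, hgG⟩ := exists_bound hg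
  obtain ⟨r, hr⟩ : ∃ r : ℝ, r = ‖c‖ * Real.exp (M * (b - a)) +
    G / M * (Real.exp (M * (b - a)) - 1) := ⟨_, rfl⟩
  have hexp : 1 ≤ Real.exp (M * (b - a)) :=
    Real.one_le_exp (mul_nonneg hM.le (sub_nonneg.2 hab))
  have hr0 : 0 ≤ r := by
    have := sub_nonneg.2 hexp
    rw [hr]; positivity
  have hL0 : 0 ≤ M * r + G := by positivity
  have hPL : IsPicardLindelof (fun t x => A t (clampVec r x) + g t)
      (⟨a, Set.left_mem_Icc.2 hab⟩ : Set.Icc a b) c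
      (Real.toNNReal ((M * r + G) * (b - a))) 0 (Real.toNNReal (M * r + G)) (Real.toNNReal M) := by
    refine ⟨?_, ?_, ?_, ?_⟩
    · intro t ht
      refine LipschitzOnWith.of_dist_le_mul fun x _ y _ => ?_
      rw [dist_eq_norm, dist_eq_norm, add_sub_add_right_eq_sub, ← map_sub,
        Real.coe_toNNReal _ hM.le]
      exact ((A t).le_opNorm _).trans (mul_le_mul (hAM t ht) (clampVec_lipschitz _ _ _)
        (norm_nonneg _) hM.le)
    · intro x _
      exact (hA.clm_apply continuousOn_const).add hg
    · intro t ht x _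
      rw [Real.coe_toNNReal _ hL0]
      refine (norm_add_le _ _).trans (add_le_add ?_ (hgG t ht))
      exact ((A t).le_opNorm _).trans (mul_le_mul (hAM t ht) (clampVec_norm_le_radius hr0 _)
        (norm_nonneg _) hM.le)
    · have h1 : 0 ≤ b - a := sub_nonneg.2 hab
      rw [Real.coe_toNNReal _ hL0, Real.coe_toNNReal _ (mul_nonneg hL0 h1)]
      simp [h1]
  obtain ⟨y, hya, hy⟩ := hPL.exists_eq_forall_mem_Icc_hasDerivWithinAt₀
  have hb : ∀ t ∈ Set.Icc a b, ‖y t‖ ≤ r := by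
    rw [hr]
    refine gronwall_within (norm_nonneg _) hM hG.le hy (by rw [← hya]) fun t ht => ?_
    refine (norm_add_le _ _).trans (add_le_add ?_ (hgG t ht))
    exact ((A t).le_opNorm _).trans (mul_le_mul (hAM t ht) (clampVec_norm_le hr0 _)
        (norm_nonneg _) hM.le)
  refine ⟨y, hya, fun t ht => ?_⟩
  have := hy t ht
  rwa [clampVec_eq _ (hb t ht)] at this

section delay
variable {n : ℕ} {τ t₀ : ℝ} {A B : ℝ → (Fin n → ℝ) →L[ℝ] (Fin n → ℝ)}

lemma delay_exists (hτ : 0 < τ) (hA : ContinuousOn A (Set.Icc t₀ (t₀ + τ)))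
    (hB : ContinuousOn B (Set.Icc t₀ (t₀ + τ))) (φ : C(Set.Icc (-τ) (0 : ℝ), Fin n → ℝ)) :
    ∃ x, IsDelaySolution n τ t₀ A B φ x := by
  have hτ' : -τ ≤ 0 := by linarith
  obtain ⟨p, hp⟩ : ∃ p : ℝ → Fin n → ℝ, p = fun s => φ (Set.projIcc (-τ) 0 hτ' s) := ⟨_, rfl⟩
  have hpc : Continuous p := by
    rw [hp]; exact φ.continuous.comp continuous_projIcc
  have hpφ : ∀ θ : Set.Icc (-τ) (0 : ℝ), p θ = φ θ := fun θ => by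
    rw [hp]; simp
  have hp0 : ∀ s, 0 ≤ s → p s = p 0 := fun s hs => by
    rw [hp]; simp [Set.projIcc_of_right_le _ hs]
  obtain ⟨y, hya, hy⟩ := linear_ode_exists (a := t₀) (b := t₀ + τ) (by linarith) hA
    (hB.clm_apply (g := fun t => p (t - τ - t₀)) (by fun_prop)) (p 0)
  have hxy : ∀ t, t₀ ≤ t → p (t - t₀) + y (max t t₀) - y t₀ = y t := fun t ht => by
    rw [hp0 _ (by linarith), max_eq_left ht, hya]; simp
  have hxp : ∀ t, t ≤ t₀ → p (t - t₀) + y (max t t₀) - y t₀ = p (t - t₀) := fun t ht => by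
    rw [max_eq_right ht]; simp
  refine ⟨fun t => p (t - t₀) + y (max t t₀) - y t₀, ?_, ?_, ?_⟩
  · have hyc : ContinuousOn y (Set.Icc t₀ (t₀ + τ)) := fun t ht => (hy t ht).continuousWithinAt
    have h1 : ContinuousOn (fun t => y (max t t₀)) (Set.Icc (t₀ - τ) (t₀ + τ)) :=
      hyc.comp (by fun_prop) fun t ht => ⟨le_max_right _ _, max_le ht.2 (by linarith)⟩
    have h2 : ContinuousOn (fun t => p (t - t₀)) (Set.Icc (t₀ - τ) (t₀ + τ)) := by fun_prop
    exact (h2.add h1).sub continuousOn_const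
  · intro θ
    have := θ.2.2
    show p (t₀ + θ - t₀) + y (max (t₀ + θ) t₀) - y t₀ = φ θ
    rw [hxp _ (by linarith), add_sub_cancel_left, hpφ]
  · intro t ht
    have h1 := hxy t ht.1
    have h2 := hxp (t - τ) (by linarith [ht.2])
    simp only
    rw [h1, h2]
    exact (hy t ht).congr (fun s hs => hxy s hs.1) h1

lemma delay_comb {φ ψ : C(Set.Icc (-τ) (0 : ℝ), Fin n → ℝ)} {x y : ℝ → Fin n → ℝ} (c : ℝ)
    (hx : IsDelaySolution n τ t₀ A B φ x) (hy : IsDelaySolution n τ t₀ A B ψ y) :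
    IsDelaySolution n τ t₀ A B (φ + c • ψ) (x + c • y) := by
  refine ⟨hx.1.add (hy.1.const_smul c), fun θ => ?_, fun t ht => ?_⟩
  · simp [hx.2.1 θ, hy.2.1 θ]
  · refine ((hx.2.2 t ht).add ((hy.2.2 t ht).const_smul c)).congr_deriv ?_
    simp only [Pi.add_apply, Pi.smul_apply, map_add, map_smul, smul_add]
    abel

/-- On the initial interval the solution is bounded by the datum. -/
lemma delay_initial {φ : C(Set.Icc (-τ) (0 : ℝ), Fin n → ℝ)} {x : ℝ → Fin n → ℝ}
    (hx : IsDelaySolution n τ t₀ A B φ x) {s : ℝ} (h1 : t₀ - τ ≤ s) (h2 : s ≤ t₀) :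
    x s = φ ⟨s - t₀, by linarith, by linarith⟩ := by
  rw [← hx.2.1]; simp

lemma delay_initial_norm {φ : C(Set.Icc (-τ) (0 : ℝ), Fin n → ℝ)} {x : ℝ → Fin n → ℝ}
    (hx : IsDelaySolution n τ t₀ A B φ x) {s : ℝ} (h1 : t₀ - τ ≤ s) (h2 : s ≤ t₀) :
    ‖x s‖ ≤ ‖φ‖ := by
  rw [delay_initial hx h1 h2]; exact φ.norm_coe_le_norm _

lemma delay_bound (hτ : 0 < τ) {R : ℝ} (hR : 0 < R)
    (hA : ∀ t ∈ Set.Icc t₀ (t₀ + τ), ‖A t‖ ≤ R) (hB : ∀ t ∈ Set.Icc t₀ (t₀ + τ), ‖B t‖ ≤ R)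
    {φ : C(Set.Icc (-τ) (0 : ℝ), Fin n → ℝ)} {x : ℝ → Fin n → ℝ}
    (hx : IsDelaySolution n τ t₀ A B φ x) :
    ∀ t ∈ Set.Icc t₀ (t₀ + τ), ‖x t‖ ≤ 2 * Real.exp (R * τ) * ‖φ‖ := by
  intro t ht
  have h := gronwall_within (δ := ‖φ‖) (K := R) (ε := R * ‖φ‖) (norm_nonneg _) hR (by positivity)
    hx.2.2 (delay_initial_norm hx (by linarith) le_rfl) (fun t ht => by
      refine (norm_add_le _ _).trans (add_le_add ?_ ?_)
      · exact (A t).le_of_opNorm_le (hA t ht) _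
      · refine ((B t).le_of_opNorm_le (hB t ht) _).trans ?_
        gcongr
        exact delay_initial_norm hx (by linarith [ht.1]) (by linarith [ht.2])) t ht
  rw [mul_div_cancel_left₀ _ hR.ne', add_sub_cancel_left] at h
  nlinarith [norm_nonneg φ]

lemma delay_unique (hτ : 0 < τ) (hA : ContinuousOn A (Set.Icc t₀ (t₀ + τ)))
    (hB : ContinuousOn B (Set.Icc t₀ (t₀ + τ))) {φ : C(Set.Icc (-τ) (0 : ℝ), Fin n → ℝ)}
    {x y : ℝ → Fin n → ℝ}
    (hx : IsDelaySolution n τ t₀ A B φ x) (hy : IsDelaySolution n τ t₀ A B φ y) :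
    Set.EqOn x y (Set.Icc (t₀ - τ) (t₀ + τ)) := by
  intro t ht
  rcases le_total t t₀ with h | h
  · rw [delay_initial hx ht.1 h, delay_initial hy ht.1 h]
  · obtain ⟨M, hM, hAM⟩ := exists_bound hA
    obtain ⟨N, hN, hBN⟩ := exists_bound hB
    have := delay_bound hτ (R := max M N) (by positivity)
      (fun t ht => (hAM t ht).trans (le_max_left _ _))
      (fun t ht => (hBN t ht).trans (le_max_right _ _)) (delay_comb (-1) hx hy) t ⟨h, ht.2⟩
    simp only [neg_smul, one_smul, add_neg_cancel, norm_zero, mul_zero, norm_le_zero_iff] at this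
    simpa [← sub_eq_add_neg, sub_eq_zero] using this

lemma delay_operator (hτ : 0 < τ) (hA : ContinuousOn A (Set.Icc t₀ (t₀ + τ)))
    (hB : ContinuousOn B (Set.Icc t₀ (t₀ + τ))) :
    ∃ U : C(Set.Icc (-τ) (0 : ℝ), Fin n → ℝ) →L[ℝ] C(Set.Icc (-τ) (0 : ℝ), Fin n → ℝ),
        ∀ φ x, IsDelaySolution n τ t₀ A B φ x →
          ∀ θ : Set.Icc (-τ) (0 : ℝ), U φ θ = x (t₀ + τ + (θ : ℝ)) := by
  choose S hS using fun φ => delay_exists hτ hA hB φ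
  have hmem : ∀ θ : Set.Icc (-τ) (0 : ℝ), t₀ + τ + (θ : ℝ) ∈ Set.Icc t₀ (t₀ + τ) :=
    fun θ => ⟨by linarith [θ.2.1], by linarith [θ.2.2]⟩
  have hsub : Set.Icc t₀ (t₀ + τ) ⊆ Set.Icc (t₀ - τ) (t₀ + τ) :=
    Set.Icc_subset_Icc_left (by linarith)
  have hc : ∀ φ, Continuous fun θ : Set.Icc (-τ) (0 : ℝ) => S φ (t₀ + τ + (θ : ℝ)) := fun φ =>
    (hS φ).1.comp_continuous (by fun_prop) fun θ => hsub (hmem θ)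
  have huniq : ∀ φ x, IsDelaySolution n τ t₀ A B φ x → ∀ θ : Set.Icc (-τ) (0 : ℝ),
      S φ (t₀ + τ + (θ : ℝ)) = x (t₀ + τ + (θ : ℝ)) := fun φ x hx θ =>
    delay_unique hτ hA hB (hS φ) hx (hsub (hmem θ))
  have h0 : IsDelaySolution n τ t₀ A B 0 0 := by
    refine ⟨continuousOn_const, fun θ => rfl, fun t ht => ?_⟩
    refine (hasDerivWithinAt_const t (Set.Icc t₀ (t₀ + τ)) (0 : Fin n → ℝ)).congr_deriv ?_
    simp
  obtain ⟨M, hM, hAM⟩ := exists_bound hA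
  obtain ⟨N, hN, hBN⟩ := exists_bound hB
  let Ul : C(Set.Icc (-τ) (0 : ℝ), Fin n → ℝ) →ₗ[ℝ] C(Set.Icc (-τ) (0 : ℝ), Fin n → ℝ) :=
    { toFun := fun φ => ⟨fun θ => S φ (t₀ + τ + (θ : ℝ)), hc φ⟩
      map_add' := fun φ ψ => by
        ext1 θ
        have := huniq _ _ (delay_comb 1 (hS φ) (hS ψ)) θ
        simpa using this
      map_smul' := fun c φ => by
        ext1 θ
        have := huniq _ _ (delay_comb c h0 (hS φ)) θ
        simpa using this }
  refine ⟨Ul.mkContinuous (2 * Real.exp (max M N * τ)) fun φ => ?_, fun φ x hx θ => ?_⟩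
  · refine (ContinuousMap.norm_le _ (by positivity)).2 fun θ => ?_
    exact delay_bound hτ (R := max M N) (by positivity)
      (fun t ht => (hAM t ht).trans (le_max_left _ _))
      (fun t ht => (hBN t ht).trans (le_max_right _ _)) (hS φ) _ (hmem θ)
  · exact huniq φ x hx θ

lemma delay_diff {Ap Bp : ℝ → (Fin n → ℝ) →L[ℝ] (Fin n → ℝ)} (hτ : 0 < τ) {R : ℝ} (hR : 0 < R)
    (hA : ContinuousOn A (Set.Icc t₀ (t₀ + τ))) (hB : ContinuousOn B (Set.Icc t₀ (t₀ + τ)))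
    (hAp : ContinuousOn Ap (Set.Icc t₀ (t₀ + τ))) (hBp : ContinuousOn Bp (Set.Icc t₀ (t₀ + τ)))
    (hAR : ∀ t ∈ Set.Icc t₀ (t₀ + τ), ‖A t‖ ≤ R) (hBR : ∀ t ∈ Set.Icc t₀ (t₀ + τ), ‖B t‖ ≤ R)
    (hApR : ∀ t ∈ Set.Icc t₀ (t₀ + τ), ‖Ap t‖ ≤ R + 1)
    {φ : C(Set.Icc (-τ) (0 : ℝ), Fin n → ℝ)} {x y : ℝ → Fin n → ℝ}
    (hx : IsDelaySolution n τ t₀ A B φ x) (hy : IsDelaySolution n τ t₀ Ap Bp φ y) :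
    ∀ t ∈ Set.Icc t₀ (t₀ + τ), ‖x t - y t‖ ≤
      Real.exp ((R + 1) * τ) * (2 * Real.exp (R * τ) * ‖φ‖ *
        ((∫ s in t₀..(t₀ + τ), ‖A s - Ap s‖) + (∫ s in t₀..(t₀ + τ), ‖B s - Bp s‖))) := by
  have hle : t₀ ≤ t₀ + τ := by linarith
  obtain ⟨q, hq⟩ : ∃ q : ℝ → Fin n → ℝ,
    q = fun t => (A t - Ap t) (x t) + (B t - Bp t) (x (t - τ)) := ⟨_, rfl⟩
  have hxc : ContinuousOn x (Set.Icc t₀ (t₀ + τ)) := hx.1.mono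
    (Set.Icc_subset_Icc_left (by linarith))
  have hxc' : ContinuousOn (fun t => x (t - τ)) (Set.Icc t₀ (t₀ + τ)) :=
    hx.1.comp (by fun_prop) fun t ht => ⟨by linarith [ht.1], by linarith [ht.2]⟩
  have hqc : ContinuousOn q (Set.Icc t₀ (t₀ + τ)) := by
    rw [hq]; exact ((hA.sub hAp).clm_apply hxc).add ((hB.sub hBp).clm_apply hxc')
  have hec : Continuous (Set.IccExtend hle ((Set.Icc t₀ (t₀ + τ)).restrict q)) :=
    (continuousOn_iff_continuous_restrict.1 hqc).Icc_extend'
  obtain ⟨w, hw⟩ : ∃ w : ℝ → Fin n → ℝ, w = fun t =>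
    ∫ s in t₀..t, Set.IccExtend hle ((Set.Icc t₀ (t₀ + τ)).restrict q) s := ⟨_, rfl⟩
  have heq : ∀ t ∈ Set.Icc t₀ (t₀ + τ),
      Set.IccExtend hle ((Set.Icc t₀ (t₀ + τ)).restrict q) t = q t := fun t ht => by
    rw [Set.IccExtend_of_mem _ _ ht]; rfl
  have hwd : ∀ t ∈ Set.Icc t₀ (t₀ + τ), HasDerivWithinAt w (q t) (Set.Icc t₀ (t₀ + τ)) t := by
    intro t ht
    have := (hec.integral_hasStrictDerivAt t₀ t).hasDerivAt.hasDerivWithinAt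
      (s := Set.Icc t₀ (t₀ + τ))
    rw [heq t ht] at this
    rw [hw]; exact this
  obtain ⟨K, hK⟩ : ∃ K : ℝ, K = 2 * Real.exp (R * τ) * ‖φ‖ := ⟨_, rfl⟩
  have hφK : ‖φ‖ ≤ K := by
    have : 1 ≤ Real.exp (R * τ) := Real.one_le_exp (by positivity)
    rw [hK]; nlinarith [norm_nonneg φ]
  have hK0 : 0 ≤ K := (norm_nonneg _).trans hφK
  have hcA : ContinuousOn (fun s => ‖A s - Ap s‖) (Set.Icc t₀ (t₀ + τ)) := (hA.sub hAp).norm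
  have hcB : ContinuousOn (fun s => ‖B s - Bp s‖) (Set.Icc t₀ (t₀ + τ)) := (hB.sub hBp).norm
  have hiA := hcA.intervalIntegrable_of_Icc (μ := MeasureTheory.volume) hle
  have hiB := hcB.intervalIntegrable_of_Icc (μ := MeasureTheory.volume) hle
  obtain ⟨I, hI⟩ : ∃ I : ℝ, I = (∫ s in t₀..(t₀ + τ), ‖A s - Ap s‖) +
    (∫ s in t₀..(t₀ + τ), ‖B s - Bp s‖) := ⟨_, rfl⟩
  have hI0 : 0 ≤ I := by
    rw [hI]
    exact add_nonneg (intervalIntegral.integral_nonneg hle fun _ _ => norm_nonneg _)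
      (intervalIntegral.integral_nonneg hle fun _ _ => norm_nonneg _)
  have hwb : ∀ t ∈ Set.Icc t₀ (t₀ + τ), ‖w t‖ ≤ K * I := by
    intro t ht
    have hig : IntervalIntegrable (fun s => K * (‖A s - Ap s‖ + ‖B s - Bp s‖))
      MeasureTheory.volume t₀ (t₀ + τ) := (hiA.add hiB).const_mul K
    have hsubset : Set.uIcc t₀ t ⊆ Set.uIcc t₀ (t₀ + τ) := by
      rw [Set.uIcc_of_le ht.1, Set.uIcc_of_le hle]; exact Set.Icc_subset_Icc_right ht.2
    have h1 : ‖w t‖ ≤ ∫ s in t₀..t, K * (‖A s - Ap s‖ + ‖B s - Bp s‖) := by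
      rw [hw]
      refine intervalIntegral.norm_integral_le_of_norm_le ht.1 (Filter.Eventually.of_forall ?_)
        (hig.mono_set hsubset)
      intro s hs
      have hs' : s ∈ Set.Icc t₀ (t₀ + τ) := ⟨hs.1.le, hs.2.trans ht.2⟩
      rw [heq s hs', hq, mul_add]
      refine (norm_add_le _ _).trans (add_le_add ?_ ?_)
      · refine ((A s - Ap s).le_opNorm _).trans ?_
        rw [mul_comm]
        gcongr
        rw [hK]; exact delay_bound hτ hR hAR hBR hx s hs'
      · refine ((B s - Bp s).le_opNorm _).trans ?_
        rw [mul_comm]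
        gcongr
        exact (delay_initial_norm hx (by linarith [hs'.1]) (by linarith [hs'.2])).trans hφK
    have h2 : ∫ s in t₀..t, K * (‖A s - Ap s‖ + ‖B s - Bp s‖) ≤
        ∫ s in t₀..(t₀ + τ), K * (‖A s - Ap s‖ + ‖B s - Bp s‖) :=
      intervalIntegral.integral_mono_interval le_rfl ht.1 ht.2
        (Filter.Eventually.of_forall fun s => by positivity) hig
    refine h1.trans (h2.trans ?_)
    rw [intervalIntegral.integral_const_mul, intervalIntegral.integral_add hiA hiB, hI]
  intro t ht
  have hp : ∀ t ∈ Set.Icc t₀ (t₀ + τ), HasDerivWithinAt (fun t => x t - y t - w t)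
      (Ap t (x t - y t)) (Set.Icc t₀ (t₀ + τ)) t := by
    intro t ht
    refine (((hx.2.2 t ht).sub (hy.2.2 t ht)).sub (hwd t ht)).congr_deriv ?_
    have : y (t - τ) = x (t - τ) := by
      rw [delay_initial hx (by linarith [ht.1]) (by linarith [ht.2]),
        delay_initial hy (by linarith [ht.1]) (by linarith [ht.2])]
    rw [hq, this]
    simp only [ContinuousLinearMap.sub_apply, map_sub]
    abel
  have h0 : ‖x t₀ - y t₀ - w t₀‖ ≤ 0 := by
    rw [delay_initial hx (by linarith) le_rfl, delay_initial hy (by linarith) le_rfl, hw]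
    simp
  have hg := gronwall_within (δ := 0) (K := R + 1) (ε := (R + 1) * (K * I)) le_rfl (by linarith)
    (by positivity) hp h0 (fun t ht => by
      refine ((Ap t).le_of_opNorm_le (hApR t ht) _).trans ?_
      rw [← mul_add]
      have := norm_add_le (x t - y t - w t) (w t)
      rw [sub_add_cancel] at this
      gcongr
      linarith [hwb t ht]) t ht
  rw [mul_div_cancel_left₀ _ (by positivity), add_sub_cancel_left] at hg
  have h3 := norm_add_le (x t - y t - w t) (w t)
  rw [sub_add_cancel] at h3
  rw [← hI, ← hK]
  linarith [hwb t ht]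

end delay

/-- For continuous coefficients `(A, B)` the linear delay system has, for each initial
datum `φ`, a unique solution, and the map `U_{A,B}` sending `φ` to the solution segment
`θ ↦ x(t₀+τ+θ)` is a bounded linear operator on `C([−τ,0], ℝⁿ)`.  Moreover, for every
`R > 0` there is `L > 0` (depending only on `R`, `n`, `τ`) such that for coefficients
bounded by `R` and perturbations within distance `1`, the operator norm of
`U_{A,B} − U_{Ap,Bp}` is at most `L·(‖A−Ap‖_{L¹} + ‖B−Bp‖_{L¹})`. -/
theorem stmt_1 (n : ℕ) (hn : 1 ≤ n) (τ : ℝ) (hτ : 0 < τ) (t₀ : ℝ) :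
    (∀ A B : ℝ → (Fin n → ℝ) →L[ℝ] (Fin n → ℝ),
      ContinuousOn A (Set.Icc t₀ (t₀ + τ)) → ContinuousOn B (Set.Icc t₀ (t₀ + τ)) →
      (∀ φ, ∃ x, IsDelaySolution n τ t₀ A B φ x) ∧
      (∀ φ x y, IsDelaySolution n τ t₀ A B φ x → IsDelaySolution n τ t₀ A B φ y →
        Set.EqOn x y (Set.Icc (t₀ - τ) (t₀ + τ))) ∧
      (∃ U : C(Set.Icc (-τ) (0 : ℝ), Fin n → ℝ) →L[ℝ]
              C(Set.Icc (-τ) (0 : ℝ), Fin n → ℝ),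
        ∀ φ x, IsDelaySolution n τ t₀ A B φ x →
          ∀ θ : Set.Icc (-τ) (0 : ℝ), U φ θ = x (t₀ + τ + (θ : ℝ)))) ∧
    (∀ R : ℝ, 0 < R → ∃ L : ℝ, 0 < L ∧
      ∀ A B Ap Bp : ℝ → (Fin n → ℝ) →L[ℝ] (Fin n → ℝ),
        ContinuousOn A (Set.Icc t₀ (t₀ + τ)) → ContinuousOn B (Set.Icc t₀ (t₀ + τ)) →
        ContinuousOn Ap (Set.Icc t₀ (t₀ + τ)) →
        ContinuousOn Bp (Set.Icc t₀ (t₀ + τ)) →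
        (∀ t ∈ Set.Icc t₀ (t₀ + τ), ‖A t‖ ≤ R) →
        (∀ t ∈ Set.Icc t₀ (t₀ + τ), ‖B t‖ ≤ R) →
        (∀ t ∈ Set.Icc t₀ (t₀ + τ), ‖Ap t - A t‖ ≤ 1) →
        (∀ t ∈ Set.Icc t₀ (t₀ + τ), ‖Bp t - B t‖ ≤ 1) →
        ∀ U Up : C(Set.Icc (-τ) (0 : ℝ), Fin n → ℝ) →L[ℝ]
                  C(Set.Icc (-τ) (0 : ℝ), Fin n → ℝ),
          (∀ φ x, IsDelaySolution n τ t₀ A B φ x →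
            ∀ θ : Set.Icc (-τ) (0 : ℝ), U φ θ = x (t₀ + τ + (θ : ℝ))) →
          (∀ φ x, IsDelaySolution n τ t₀ Ap Bp φ x →
            ∀ θ : Set.Icc (-τ) (0 : ℝ), Up φ θ = x (t₀ + τ + (θ : ℝ))) →
          ‖U - Up‖ ≤ L * ((∫ s in t₀..(t₀ + τ), ‖A s - Ap s‖) +
                          (∫ s in t₀..(t₀ + τ), ‖B s - Bp s‖))) := by
  refine ⟨fun A B hA hB => ⟨fun φ => delay_exists hτ hA hB φ,
    fun φ x y hx hy => delay_unique hτ hA hB hx hy, delay_operator hτ hA hB⟩, fun R hR => ?_⟩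
  refine ⟨Real.exp ((R + 1) * τ) * (2 * Real.exp (R * τ)), by positivity, ?_⟩
  intro A B Ap Bp hA hB hAp hBp hAR hBR hA1 hB1 U Up hU hUp
  have hle : t₀ ≤ t₀ + τ := by linarith
  have hI0 : 0 ≤ (∫ s in t₀..(t₀ + τ), ‖A s - Ap s‖) + (∫ s in t₀..(t₀ + τ), ‖B s - Bp s‖) :=
    add_nonneg (intervalIntegral.integral_nonneg hle fun _ _ => norm_nonneg _)
      (intervalIntegral.integral_nonneg hle fun _ _ => norm_nonneg _)
  refine ContinuousLinearMap.opNorm_le_bound _ (by positivity) fun φ => ?_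
  refine (ContinuousMap.norm_le _ (by positivity)).2 fun θ => ?_
  obtain ⟨x, hx⟩ := delay_exists hτ hA hB φ
  obtain ⟨y, hy⟩ := delay_exists hτ hAp hBp φ
  have h := delay_diff hτ hR hA hB hAp hBp hAR hBR (fun t ht => by
    have := norm_add_le (Ap t - A t) (A t)
    rw [sub_add_cancel] at this
    linarith [hA1 t ht, hAR t ht]) hx hy (t₀ + τ + θ)
    ⟨by linarith [θ.2.1], by linarith [θ.2.2]⟩
  rw [ContinuousLinearMap.sub_apply, ContinuousMap.sub_apply, hU φ x hx θ, hUp φ y hy θ]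
  refine h.trans (le_of_eq ?_)
  ring
end

section
/- Let X be a compact metric space and F a continuous semiflow on X such that every time-t map F(t,·) : X → X is injective. Let M ⊆ X be a set such that every ψ ∈ M admits a complete flow line in M, i.e. a function y : ℝ → M with y(0) = ψ and y(t) = F(t−s, y(s)) whenever t ≥ s. Then for each ψ ∈ M such a function y^ψ is unique, and the map F_M : ℝ × M → M defined by F_M(t,ψ) := y^ψ(t) is a continuous flow on M which agrees with F on [0,∞) × M. -/
/-- Let `F` be a continuous semiflow on a compact metric space `X` with all time-`t`
maps injective, and let `M ⊆ X` be such that every `ψ ∈ M` admits a complete flow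
line in `M`.  Then the complete flow line through each `ψ ∈ M` is unique, and setting
`F_M(t, ψ) := y^ψ(t)` defines a continuous flow on `M` agreeing with `F` on
`[0,∞) × M`. -/
theorem stmt_2 {X : Type*} [MetricSpace X] [CompactSpace X]
    (F : ℝ → X → X)
    (Fcont : ContinuousOn (fun q : ℝ × X => F q.1 q.2) (Set.Ici 0 ×ˢ Set.univ))
    (F0 : ∀ x : X, F 0 x = x)
    (Fsemi : ∀ t s : ℝ, 0 ≤ t → 0 ≤ s → ∀ x : X, F (t + s) x = F t (F s x))
    (Finj : ∀ t : ℝ, 0 ≤ t → Function.Injective (F t))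
    (M : Set X)
    (hM : ∀ ψ ∈ M, ∃ y : ℝ → X, (∀ t, y t ∈ M) ∧ y 0 = ψ ∧
      ∀ s t : ℝ, s ≤ t → y t = F (t - s) (y s)) :
    (∀ ψ ∈ M, ∃! y : ℝ → X, (∀ t, y t ∈ M) ∧ y 0 = ψ ∧
      ∀ s t : ℝ, s ≤ t → y t = F (t - s) (y s)) ∧
    ∃ G : ℝ → X → X,
      (∀ ψ ∈ M, ∀ y : ℝ → X,
        ((∀ t, y t ∈ M) ∧ y 0 = ψ ∧ ∀ s t : ℝ, s ≤ t → y t = F (t - s) (y s)) →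
        ∀ t, G t ψ = y t) ∧
      (∀ t : ℝ, ∀ ψ ∈ M, G t ψ ∈ M) ∧
      ContinuousOn (fun q : ℝ × X => G q.1 q.2) (Set.univ ×ˢ M) ∧
      (∀ ψ ∈ M, G 0 ψ = ψ) ∧
      (∀ t s : ℝ, ∀ ψ ∈ M, G (t + s) ψ = G t (G s ψ)) ∧
      (∀ t : ℝ, 0 ≤ t → ∀ ψ ∈ M, G t ψ = F t ψ) := by
  have uniq : ∀ ψ : X, ∀ y z : ℝ → X,
      ((∀ t, y t ∈ M) ∧ y 0 = ψ ∧ ∀ s t : ℝ, s ≤ t → y t = F (t - s) (y s)) →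
      ((∀ t, z t ∈ M) ∧ z 0 = ψ ∧ ∀ s t : ℝ, s ≤ t → z t = F (t - s) (z s)) →
      ∀ t, y t = z t := by
    rintro ψ y z ⟨-, hy0, hy⟩ ⟨-, hz0, hz⟩ t
    rcases le_total 0 t with ht | ht
    · rw [hy 0 t ht, hz 0 t ht, hy0, hz0]
    · apply Finj (0 - t) (by linarith)
      rw [← hy t 0 ht, ← hz t 0 ht, hy0, hz0]
  refine ⟨?_, ?_⟩
  · intro ψ hψ
    obtain ⟨y, hy⟩ := hM ψ hψ
    exact ⟨y, hy, fun z hz => funext (uniq ψ z y hz hy)⟩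
  classical
  choose Y hY using hM
  obtain ⟨G, hG⟩ : ∃ G : ℝ → X → X, ∀ t ψ (h : ψ ∈ M), G t ψ = Y ψ h t :=
    ⟨fun t ψ => if h : ψ ∈ M then Y ψ h t else ψ, fun t ψ h => by simp [h]⟩
  have hGM : ∀ t : ℝ, ∀ ψ ∈ M, G t ψ ∈ M := fun t ψ h => by
    rw [hG t ψ h]; exact (hY ψ h).1 t
  have hGF : ∀ s t : ℝ, s ≤ t → ∀ ψ ∈ M, G t ψ = F (t - s) (G s ψ) := fun s t hst ψ h => by
    rw [hG t ψ h, hG s ψ h]; exact (hY ψ h).2.2 s t hst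
  have hG0 : ∀ ψ ∈ M, G 0 ψ = ψ := fun ψ h => by
    rw [hG 0 ψ h]; exact (hY ψ h).2.1
  have hGu : ∀ ψ ∈ M, ∀ y : ℝ → X,
        ((∀ t, y t ∈ M) ∧ y 0 = ψ ∧ ∀ s t : ℝ, s ≤ t → y t = F (t - s) (y s)) →
        ∀ t, G t ψ = y t := fun ψ h y hy t => by
    rw [hG t ψ h]; exact uniq ψ _ _ (hY ψ h) hy t
  have hback : ∀ T : ℝ, 0 ≤ T → ContinuousOn (G (-T)) M := by
    intro T hT
    have hc : Continuous (F T) := by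
      have h1 := Fcont.comp (f := fun x : X => (T, x)) (s := Set.univ)
        (by fun_prop) (fun x _ => ⟨hT, Set.mem_univ _⟩)
      exact continuousOn_univ.1 h1
    have he := (hc.isClosedEmbedding (Finj T hT)).isInducing
    rw [he.continuousOn_iff]
    refine continuousOn_id.congr fun ψ h => ?_
    have h2 := hGF (-T) 0 (by linarith) ψ h
    rw [hG0 ψ h, zero_sub, neg_neg] at h2
    exact h2.symm
  refine ⟨G, hGu, hGM, ?_, hG0, ?_, ?_⟩
  · rintro ⟨t₀, ψ₀⟩ ⟨-, hψ₀⟩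
    set T : ℝ := |t₀| + 1 with hTdef
    have hT : 0 ≤ T := by positivity
    have hlt : -T < t₀ := by have := neg_abs_le t₀; linarith
    have hcont : ContinuousOn (fun q : ℝ × X => F (q.1 + T) (G (-T) q.2))
        (Set.Ioi (-T) ×ˢ M) := by
      refine Fcont.comp (f := fun q : ℝ × X => (q.1 + T, G (-T) q.2)) ?_ ?_
      · refine ContinuousOn.prodMk (by fun_prop) ?_
        exact (hback T hT).comp continuousOn_snd (fun q hq => hq.2)
      · rintro ⟨t, ψ⟩ ⟨ht, -⟩
        have ht' : -T < t := ht
        exact ⟨by simp only [Set.mem_Ici]; linarith, Set.mem_univ _⟩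
    have hcont2 : ContinuousOn (fun q : ℝ × X => G q.1 q.2) (Set.Ioi (-T) ×ˢ M) := by
      refine hcont.congr ?_
      rintro ⟨t, ψ⟩ ⟨ht, h⟩
      have ht' : -T < t := ht
      have := hGF (-T) t ht'.le ψ h
      rwa [sub_neg_eq_add] at this
    refine (hcont2 (t₀, ψ₀) ⟨hlt, hψ₀⟩).mono_of_mem_nhdsWithin ?_
    have hn : (Set.Ioi (-T) ×ˢ Set.univ : Set (ℝ × X)) ∈ nhds (t₀, ψ₀) :=
      (isOpen_Ioi.prod isOpen_univ).mem_nhds ⟨hlt, Set.mem_univ _⟩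
    filter_upwards [mem_nhdsWithin_of_mem_nhds hn, self_mem_nhdsWithin] with q h1 h2
    exact ⟨h1.1, h2.2⟩
  · intro t s ψ h
    refine (hGu (G s ψ) (hGM s ψ h) (fun t => G (t + s) ψ)
      ⟨fun t => hGM _ ψ h, by simp, fun a b hab => ?_⟩ t).symm
    have := hGF (a + s) (b + s) (by linarith) ψ h
    rwa [add_sub_add_right_eq_sub] at this
  · intro t ht ψ h
    have := hGF 0 t ht ψ h
    rwa [hG0 ψ h, sub_zero] at this
end

section
/- Let X be a metric space, Φ a continuous semiflow on X, and B ⊆ X a nonempty set such that Φ(t,·)(B) ⊆ B for all t ≥ 0 and such that the closure of Φ(τ,·)(B) is compact for some τ > 0. Define 𝒜 := ⋂_{t ≥ 0} closure(Φ(t,·)(B)). Then 𝒜 is a nonempty compact set and Φ(s,·)(𝒜) = 𝒜 for every s ≥ 0. -/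
/-- If `Φ` is a continuous semiflow on a metric space, `B` a nonempty forward-invariant
set whose image at some time `τ > 0` has compact closure, then the attractor
`𝒜 = ⋂_{t ≥ 0} closure(Φ(t,·)(B))` is nonempty, compact and fully invariant:
`Φ(s,·)(𝒜) = 𝒜` for every `s ≥ 0`. -/
theorem stmt_3 {X : Type*} [MetricSpace X]
    (Φ : ℝ → X → X)
    (hcont : ContinuousOn (fun q : ℝ × X => Φ q.1 q.2) (Set.Ici 0 ×ˢ Set.univ))
    (h0 : ∀ x : X, Φ 0 x = x)
    (hsemi : ∀ t s : ℝ, 0 ≤ t → 0 ≤ s → ∀ x : X, Φ (t + s) x = Φ t (Φ s x))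
    (B : Set X) (hB : B.Nonempty)
    (hinv : ∀ t : ℝ, 0 ≤ t → Φ t '' B ⊆ B)
    (τ : ℝ) (hτ : 0 < τ) (hcpt : IsCompact (closure (Φ τ '' B))) :
    (⋂ t ∈ Set.Ici (0 : ℝ), closure (Φ t '' B)).Nonempty ∧
    IsCompact (⋂ t ∈ Set.Ici (0 : ℝ), closure (Φ t '' B)) ∧
    ∀ s : ℝ, 0 ≤ s →
      Φ s '' (⋂ t ∈ Set.Ici (0 : ℝ), closure (Φ t '' B)) =
        ⋂ t ∈ Set.Ici (0 : ℝ), closure (Φ t '' B) := by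
  have hc : ∀ s : ℝ, 0 ≤ s → Continuous (Φ s) := by
    intro s hs
    have : Continuous (fun x : X => (fun q : ℝ × X => Φ q.1 q.2) (s, x)) :=
      hcont.comp_continuous (by fun_prop) (fun x => ⟨hs, trivial⟩)
    exact this
  have anti : ∀ t u : ℝ, 0 ≤ t → t ≤ u → closure (Φ u '' B) ⊆ closure (Φ t '' B) := by
    intro t u ht htu
    apply closure_mono
    rintro _ ⟨b, hb, rfl⟩
    refine ⟨Φ (u - t) b, hinv (u - t) (by linarith) ⟨b, hb, rfl⟩, ?_⟩
    rw [← hsemi t (u - t) ht (by linarith)]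
    congr 1
    ring
  have cpt : ∀ t : ℝ, τ ≤ t → IsCompact (closure (Φ t '' B)) := fun t ht =>
    hcpt.of_isClosed_subset isClosed_closure (anti τ t hτ.le ht)
  have key : ∀ F : Set X, IsClosed F →
      (∀ n : ℕ, (closure (Φ (τ + n) '' B) ∩ F).Nonempty) →
      ((⋂ t ∈ Set.Ici (0 : ℝ), closure (Φ t '' B)) ∩ F).Nonempty := by
    intro F hF hne
    obtain ⟨x, hx⟩ := IsCompact.nonempty_iInter_of_sequence_nonempty_isCompact_isClosed
      (fun n : ℕ => closure (Φ (τ + n) '' B) ∩ F)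
      (fun n => Set.inter_subset_inter_left _
        (anti _ _ (by positivity) (by push_cast; linarith)))
      hne ((cpt _ (by simp)).inter_right hF) (fun n => isClosed_closure.inter hF)
    rw [Set.mem_iInter] at hx
    refine ⟨x, ?_, (hx 0).2⟩
    simp only [Set.mem_iInter]
    intro t ht
    obtain ⟨n, hn⟩ := exists_nat_ge t
    exact anti t (τ + n) ht (by linarith) (hx n).1
  refine ⟨?_, ?_, ?_⟩
  · obtain ⟨x, hx, -⟩ := key Set.univ isClosed_univ (fun n => by
      rw [Set.inter_univ]
      exact (hB.image _).closure)
    exact ⟨x, hx⟩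
  · refine hcpt.of_isClosed_subset
      (isClosed_biInter fun _ _ => isClosed_closure) ?_
    exact Set.biInter_subset_of_mem (show τ ∈ Set.Ici (0 : ℝ) from hτ.le)
  · intro s hs
    apply Set.Subset.antisymm
    · rintro _ ⟨x, hx, rfl⟩
      simp only [Set.mem_iInter] at hx ⊢
      intro t ht
      have h1 : Φ s x ∈ closure (Φ s '' (Φ t '' B)) :=
        image_closure_subset_closure_image (hc s hs) ⟨x, hx t ht, rfl⟩
      refine closure_mono ?_ h1
      rintro _ ⟨_, ⟨b, hb, rfl⟩, rfl⟩
      refine ⟨Φ s b, hinv s hs ⟨b, hb, rfl⟩, ?_⟩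
      rw [← hsemi t s ht hs, ← hsemi s t hs ht, add_comm]
    · intro y hy
      simp only [Set.mem_iInter] at hy
      obtain ⟨x, hx, hxy⟩ := key (Φ s ⁻¹' {y}) (isClosed_singleton.preimage (hc s hs)) (by
        intro n
        have hn : 0 ≤ τ + n := by positivity
        have hcl : IsClosed (Φ s '' closure (Φ (τ + n) '' B)) :=
          ((cpt (τ + n) (by simp)).image (hc s hs)).isClosed
        have hsub : closure (Φ (s + (τ + n)) '' B) ⊆ Φ s '' closure (Φ (τ + n) '' B) := by
          apply closure_minimal _ hcl
          rintro _ ⟨b, hb, rfl⟩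
          exact ⟨Φ (τ + n) b, subset_closure ⟨b, hb, rfl⟩, (hsemi s _ hs hn b).symm⟩
        obtain ⟨x, hx, hxy⟩ := hsub (hy _ (show (0 : ℝ) ≤ _ by positivity))
        exact ⟨x, hx, hxy⟩)
      exact ⟨x, hx, hxy⟩
end

section
/- Let X be a metric space, Φ a continuous semiflow on X, and B ⊆ X a nonempty set such that Φ(t,·)(B) ⊆ B for all t ≥ 0 and such that the closure of Φ(τ,·)(B) is compact for some τ > 0; define 𝒜 := ⋂_{t ≥ 0} closure(Φ(t,·)(B)). Assume in addition that every time-t map Φ(t,·) : X → X is injective. Then there is a unique continuous flow Φ_𝒜 : ℝ × 𝒜 → 𝒜 such that Φ_𝒜(t,ψ) = Φ(t,ψ) for all t ≥ 0 and ψ ∈ 𝒜. -/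
/-- Under the hypotheses of the attractor construction, if in addition all time-`t`
maps `Φ(t,·)` are injective, then there is a unique continuous flow
`Φ_𝒜 : ℝ × 𝒜 → 𝒜` on the attractor `𝒜 = ⋂_{t ≥ 0} closure(Φ(t,·)(B))` extending the
semiflow `Φ`. -/
theorem stmt_4 {X : Type*} [MetricSpace X]
    (Φ : ℝ → X → X)
    (hcont : ContinuousOn (fun q : ℝ × X => Φ q.1 q.2) (Set.Ici 0 ×ˢ Set.univ))
    (h0 : ∀ x : X, Φ 0 x = x)
    (hsemi : ∀ t s : ℝ, 0 ≤ t → 0 ≤ s → ∀ x : X, Φ (t + s) x = Φ t (Φ s x))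
    (hinj : ∀ t : ℝ, 0 ≤ t → Function.Injective (Φ t))
    (B : Set X) (hB : B.Nonempty)
    (hinv : ∀ t : ℝ, 0 ≤ t → Φ t '' B ⊆ B)
    (τ : ℝ) (hτ : 0 < τ) (hcpt : IsCompact (closure (Φ τ '' B)))
    (𝒜 : Set X) (h𝒜 : 𝒜 = ⋂ t ∈ Set.Ici (0 : ℝ), closure (Φ t '' B)) :
    ∃! G : ℝ → 𝒜 → 𝒜,
      Continuous (fun q : ℝ × 𝒜 => G q.1 q.2) ∧
      (∀ ψ : 𝒜, G 0 ψ = ψ) ∧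
      (∀ t s : ℝ, ∀ ψ : 𝒜, G (t + s) ψ = G t (G s ψ)) ∧
      (∀ t : ℝ, 0 ≤ t → ∀ ψ : 𝒜, (G t ψ : X) = Φ t (ψ : X)) := by
  -- basic facts
  have hct : ∀ t : ℝ, 0 ≤ t → Continuous (Φ t) := by
    intro t ht
    have : Continuous ((fun q : ℝ × X => Φ q.1 q.2) ∘ fun x : X => (t, x)) :=
      hcont.comp_continuous (by fun_prop) (fun x => ⟨ht, Set.mem_univ _⟩)
    exact this
  have hanti : ∀ t s : ℝ, 0 ≤ t → t ≤ s → Φ s '' B ⊆ Φ t '' B := by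
    rintro t s ht hts _ ⟨b, hb, rfl⟩
    refine ⟨Φ (s - t) b, hinv (s - t) (by linarith) ⟨b, hb, rfl⟩, ?_⟩
    rw [← hsemi t (s - t) ht (by linarith)]
    congr 1; ring
  have hmem : ∀ x : X, x ∈ 𝒜 ↔ ∀ t : ℝ, 0 ≤ t → x ∈ closure (Φ t '' B) := by
    intro x; rw [h𝒜]; simp
  have hAcl : IsClosed 𝒜 := by
    rw [h𝒜]
    exact isClosed_biInter fun t _ => isClosed_closure
  have hKc : ∀ s : ℝ, τ ≤ s → IsCompact (closure (Φ s '' B)) := fun s hs =>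
    hcpt.of_isClosed_subset isClosed_closure (closure_mono (hanti τ s hτ.le hs))
  have hAc : IsCompact 𝒜 :=
    hcpt.of_isClosed_subset hAcl (fun x hx => (hmem x).1 hx τ hτ.le)
  have hfwd : ∀ t : ℝ, 0 ≤ t → ∀ x ∈ 𝒜, Φ t x ∈ 𝒜 := by
    intro t ht x hx
    rw [hmem] at hx ⊢
    intro s hs
    refine map_mem_closure (hct t ht) (hx s hs) ?_
    rintro _ ⟨b, hb, rfl⟩
    refine ⟨Φ t b, hinv t ht ⟨b, hb, rfl⟩, ?_⟩
    rw [← hsemi s t hs ht, ← hsemi t s ht hs, add_comm]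
  have hsurj : ∀ t : ℝ, 0 ≤ t → ∀ y ∈ 𝒜, ∃ x ∈ 𝒜, Φ t x = y := by
    intro t ht y hy
    have key : ∀ s : ℝ, τ ≤ s → ∃ x ∈ closure (Φ s '' B), Φ t x = y := by
      intro s hs
      have hs0 : 0 ≤ s := hτ.le.trans hs
      have h1 : closure (Φ (t + s) '' B) ⊆ Φ t '' closure (Φ s '' B) := by
        refine closure_minimal ?_ ((hKc s hs).image (hct t ht)).isClosed
        rintro _ ⟨b, hb, rfl⟩
        exact ⟨Φ s b, subset_closure ⟨b, hb, rfl⟩, (hsemi t s ht hs0 b).symm⟩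
      exact h1 ((hmem y).1 hy (t + s) (by linarith))
    obtain ⟨x, -, hxy⟩ := key τ le_rfl
    refine ⟨x, (hmem x).2 fun s hs => ?_, hxy⟩
    obtain ⟨z, hz, hzy⟩ := key (max s τ) (le_max_right _ _)
    have : z = x := hinj t ht (hzy.trans hxy.symm)
    subst this
    exact closure_mono (hanti s _ hs (le_max_left _ _)) hz
  have hex : ∀ (t : ℝ) (ψ : 𝒜), ∃ a : 𝒜, Φ |t| (a : X) = Φ (|t| + t) (ψ : X) := by
    intro t ψ
    obtain ⟨x, hx, h⟩ := hsurj |t| (abs_nonneg t) _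
      (hfwd (|t| + t) (by linarith [neg_abs_le t]) ψ ψ.2)
    exact ⟨⟨x, hx⟩, h⟩
  choose G hG using hex
  have hGs : ∀ (t : ℝ) (ψ : 𝒜) (s : ℝ), 0 ≤ s → 0 ≤ s + t →
      Φ s (G t ψ : X) = Φ (s + t) (ψ : X) := by
    intro t ψ s hs hst
    have ha := abs_nonneg t
    have hat : 0 ≤ |t| + t := by linarith [neg_abs_le t]
    apply hinj |t| ha
    rw [← hsemi _ _ ha hs, add_comm, hsemi _ _ hs ha, hG, ← hsemi _ _ hs hat,
      ← hsemi _ _ ha hst]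
    congr 1; ring
  refine ⟨G, ⟨?_, ?_, ?_, ?_⟩, ?_⟩
  · have : CompactSpace 𝒜 := isCompact_iff_compactSpace.1 hAc
    rw [continuous_iff_continuousAt]
    rintro ⟨t₀, ψ₀⟩
    have hs : (0 : ℝ) ≤ |t₀| + 1 := by positivity
    have hemb : Topology.IsClosedEmbedding (fun a : 𝒜 => Φ (|t₀| + 1) (a : X)) :=
      Continuous.isClosedEmbedding ((hct _ hs).comp continuous_subtype_val)
        (fun a b h => Subtype.ext (hinj _ hs h))
    rw [hemb.isInducing.continuousAt_iff]
    have hU : {q : ℝ × 𝒜 | 0 < |t₀| + 1 + q.1} ∈ nhds (t₀, ψ₀) := by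
      apply (isOpen_lt (by fun_prop) (by fun_prop)).mem_nhds
      show 0 < |t₀| + 1 + t₀
      linarith [neg_abs_le t₀]
    have hc : ContinuousOn (fun q : ℝ × 𝒜 => Φ (|t₀| + 1 + q.1) (q.2 : X))
        {q : ℝ × 𝒜 | 0 < |t₀| + 1 + q.1} :=
      hcont.comp (f := fun q : ℝ × 𝒜 => (|t₀| + 1 + q.1, (q.2 : X)))
        (by fun_prop) (fun q hq => ⟨Set.mem_Ici.2 (le_of_lt hq), Set.mem_univ _⟩)
    refine (hc.continuousAt hU).congr ?_
    filter_upwards [hU] with q hq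
    exact (hGs q.1 q.2 _ hs (le_of_lt hq)).symm
  · intro ψ
    have := hGs 0 ψ 0 le_rfl (by simp)
    simp only [add_zero, h0] at this
    exact Subtype.ext this
  · intro t s ψ
    have h1 := neg_abs_le t
    have h2 := neg_abs_le s
    have h3 := abs_nonneg t
    have h4 := abs_nonneg s
    apply Subtype.ext
    apply hinj (|t| + |s|) (by linarith)
    rw [hGs _ _ _ (by linarith) (by linarith), hGs _ _ _ (by linarith) (by linarith),
      hGs _ _ _ (by linarith) (by linarith), add_assoc (|t| + |s|)]
  · intro t ht ψ
    have := hGs t ψ 0 le_rfl (by simpa using ht)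
    simpa only [zero_add, h0] using this
  · rintro G' ⟨-, -, hadd, hext⟩
    funext t ψ
    apply Subtype.ext
    apply hinj |t| (abs_nonneg t)
    rw [hG, ← hext _ (abs_nonneg t), ← hadd, hext _ (by linarith [neg_abs_le t])]
end

section
/- The functional V : 𝕏 ∖ {0} → ℕ ∪ {∞} is lower semicontinuous with respect to the norm of 𝕏: whenever ψ_n → ψ in 𝕏 with ψ ≠ 0 and all ψ_n ≠ 0, one has V(ψ) ≤ liminf_{n→∞} V(ψ_n). -/
attribute [local instance] Classical.propDecidable

/-- The domain `D = [−τ,0] ∪ {1,…,N}` on which an element of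
`𝕏 = C([−τ,0],ℝ) × ℝ^N` is regarded as a real-valued function. -/
def lyapDom (τ : ℝ) (N : ℕ) : Set ℝ :=
  Set.Icc (-τ) 0 ∪ {θ : ℝ | ∃ i : Fin N, θ = (i : ℝ) + 1}

/-- Evaluation of `ψ = (φ, x₁,…,x_N) ∈ 𝕏` as a function on `D`. -/
noncomputable def lyapEval {τ : ℝ} {N : ℕ}
    (ψ : C(Set.Icc (-τ) (0 : ℝ), ℝ) × (Fin N → ℝ)) (θ : ℝ) : ℝ :=
  if h : θ ∈ Set.Icc (-τ) (0 : ℝ) then ψ.1 ⟨θ, h⟩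
  else if h' : ∃ i : Fin N, θ = (i : ℝ) + 1 then ψ.2 h'.choose
  else 0

/-- The sign-change number `sc(ψ) ∈ ℕ ∪ {∞}`: the supremum of all `k` for which there
are `θ₀ < θ₁ < … < θ_k` in `D` with `x(θ_{i−1})·x(θ_i) < 0` for `i = 1,…,k`
(with `sup ∅ = 0`). -/
noncomputable def lyapSC {τ : ℝ} {N : ℕ}
    (ψ : C(Set.Icc (-τ) (0 : ℝ), ℝ) × (Fin N → ℝ)) : ℕ∞ :=
  sSup {k : ℕ∞ | ∃ m : ℕ, k = (m : ℕ∞) ∧ ∃ θ : Fin (m + 1) → ℝ,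
    StrictMono θ ∧ (∀ i, θ i ∈ lyapDom τ N) ∧
    ∀ i : Fin m, lyapEval ψ (θ i.castSucc) * lyapEval ψ (θ i.succ) < 0}

/-- The discrete Lyapunov functional `V(ψ)`: equal to `sc(ψ)` if this is odd or
infinite, and to `sc(ψ) + 1` if `sc(ψ)` is even. -/
noncomputable def lyapV {τ : ℝ} {N : ℕ}
    (ψ : C(Set.Icc (-τ) (0 : ℝ), ℝ) × (Fin N → ℝ)) : ℕ∞ :=
  if ∃ m : ℕ, lyapSC ψ = (m : ℕ∞) ∧ Even m then lyapSC ψ + 1 else lyapSC ψ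

theorem continuous_lyapEval {τ : ℝ} {N : ℕ} (θ : ℝ) :
    Continuous (fun ψ : C(Set.Icc (-τ) (0 : ℝ), ℝ) × (Fin N → ℝ) => lyapEval ψ θ) := by
  unfold lyapEval
  split_ifs with h h'
  · exact (continuous_eval_const (F := C(Set.Icc (-τ) (0 : ℝ), ℝ)) _).comp continuous_fst
  · exact (continuous_apply _).comp continuous_snd
  · exact continuous_const

theorem eventually_le_lyapSC {τ : ℝ} {N : ℕ}
    (ψ : C(Set.Icc (-τ) (0 : ℝ), ℝ) × (Fin N → ℝ)) (n : ℕ) (hn : (n : ℕ∞) ≤ lyapSC ψ) :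
    ∀ᶠ χ in nhds ψ, (n : ℕ∞) ≤ lyapSC χ := by
  rcases n with _ | n
  · simp
  have h1 : (n : ℕ∞) < lyapSC ψ :=
    lt_of_lt_of_le (by exact_mod_cast Nat.lt_succ_self n) hn
  unfold lyapSC at h1
  obtain ⟨k, ⟨m, rfl, θ, hmono, hdom, hs⟩, hk⟩ := lt_sSup_iff.1 h1
  have hev : ∀ᶠ χ in nhds ψ, ∀ i : Fin m,
      lyapEval χ (θ i.castSucc) * lyapEval χ (θ i.succ) < 0 := by
    rw [Filter.eventually_all]
    intro i
    exact ((continuous_lyapEval (θ i.castSucc)).mul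
      (continuous_lyapEval (θ i.succ))).continuousAt.eventually_lt continuousAt_const (hs i)
  filter_upwards [hev] with χ hχ
  have h2 : (m : ℕ∞) ≤ lyapSC χ := le_sSup ⟨m, rfl, θ, hmono, hdom, hχ⟩
  refine le_trans ?_ h2
  have : n < m := by exact_mod_cast hk
  exact_mod_cast this

theorem lyapSC_le_lyapV {τ : ℝ} {N : ℕ}
    (ψ : C(Set.Icc (-τ) (0 : ℝ), ℝ) × (Fin N → ℝ)) : lyapSC ψ ≤ lyapV ψ := by
  unfold lyapV
  split_ifs
  · exact le_self_add
  · exact le_rfl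

theorem lyapV_mono {τ : ℝ} {N : ℕ}
    (ψ χ : C(Set.Icc (-τ) (0 : ℝ), ℝ) × (Fin N → ℝ)) (h : lyapSC ψ ≤ lyapSC χ) :
    lyapV ψ ≤ lyapV χ := by
  by_cases hp : ∃ m : ℕ, lyapSC ψ = (m : ℕ∞) ∧ Even m
  · rcases h.eq_or_lt with he | hl
    · unfold lyapV
      rw [he]
    · have : lyapV ψ = lyapSC ψ + 1 := if_pos hp
      rw [this]
      exact (Order.add_one_le_of_lt hl).trans (lyapSC_le_lyapV χ)
  · have : lyapV ψ = lyapSC ψ := if_neg hp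
    rw [this]
    exact h.trans (lyapSC_le_lyapV χ)

/-- The discrete Lyapunov functional `V` is lower semicontinuous on `𝕏 ∖ {0}`:
if `ψ_n → ψ` with `ψ ≠ 0` and all `ψ_n ≠ 0`, then `V(ψ) ≤ liminf V(ψ_n)`. -/
theorem stmt_5 (τ : ℝ) (hτ : 0 < τ) (N : ℕ)
    (ψ : C(Set.Icc (-τ) (0 : ℝ), ℝ) × (Fin N → ℝ)) (hψ : ψ ≠ 0)
    (u : ℕ → C(Set.Icc (-τ) (0 : ℝ), ℝ) × (Fin N → ℝ)) (hu : ∀ k, u k ≠ 0)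
    (hconv : Filter.Tendsto u Filter.atTop (nhds ψ)) :
    lyapV ψ ≤ Filter.liminf (fun k => lyapV (u k)) Filter.atTop := by
  by_cases htop : lyapSC ψ = ⊤
  · have key : ∀ n : ℕ, (n : ℕ∞) ≤ Filter.liminf (fun k => lyapV (u k)) Filter.atTop := by
      intro n
      refine Filter.le_liminf_of_le (by isBoundedDefault) ?_
      filter_upwards [hconv.eventually (eventually_le_lyapSC ψ n (by simp [htop]))] with k hk
      exact hk.trans (lyapSC_le_lyapV _)
    rw [ENat.eq_top_iff_forall_ge.2 key]
    exact le_top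
  · obtain ⟨n, hn⟩ := ENat.ne_top_iff_exists.1 htop
    refine Filter.le_liminf_of_le (by isBoundedDefault) ?_
    filter_upwards [hconv.eventually (eventually_le_lyapSC ψ n hn.le)] with k hk
    exact lyapV_mono _ _ (hn ▸ hk)
end

section
/- Let Σ := {ψ ∈ 𝕏 ∖ {0} : V(ψ) = 1}. Then the closure of Σ in 𝕏 equals Σ ∪ {0}. -/
attribute [local instance] Classical.propDecidable

lemma lyapV_eq_one_iff_sc {τ : ℝ} {N : ℕ}
    (ψ : C(Set.Icc (-τ) (0 : ℝ), ℝ) × (Fin N → ℝ)) : lyapV ψ = 1 ↔ lyapSC ψ ≤ 1 := by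
  unfold lyapV
  generalize lyapSC ψ = s
  induction s using ENat.recTopCoe with
  | top => simp
  | coe m =>
    have h1 : (∃ k : ℕ, (m : ℕ∞) = (k : ℕ∞) ∧ Even k) ↔ Even m := by
      constructor
      · rintro ⟨k, hk, he⟩
        rw [Nat.cast_inj] at hk
        rwa [hk]
      · exact fun h => ⟨m, rfl, h⟩
    simp only [h1]
    split_ifs with h
    · have : ((m : ℕ∞) + 1 = 1) ↔ (m + 1 = 1) := by exact_mod_cast Iff.rfl
      rw [this]
      have : ((m : ℕ∞) ≤ 1) ↔ m ≤ 1 := by exact_mod_cast Iff.rfl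
      rw [this]
      grind
    · have : ((m : ℕ∞) = 1) ↔ (m = 1) := by exact_mod_cast Iff.rfl
      rw [this]
      have : ((m : ℕ∞) ≤ 1) ↔ m ≤ 1 := by exact_mod_cast Iff.rfl
      rw [this]
      grind

lemma lyapSC_le_one_iff {τ : ℝ} {N : ℕ}
    (ψ : C(Set.Icc (-τ) (0 : ℝ), ℝ) × (Fin N → ℝ)) :
    lyapSC ψ ≤ 1 ↔ ∀ a ∈ lyapDom τ N, ∀ b ∈ lyapDom τ N, ∀ c ∈ lyapDom τ N, a < b → b < c →
      (0 ≤ lyapEval ψ a * lyapEval ψ b ∨ 0 ≤ lyapEval ψ b * lyapEval ψ c) := by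
  unfold lyapSC
  rw [sSup_le_iff]
  constructor
  · intro h a ha b hb c hc hab hbc
    by_contra! hn
    have := h (2 : ℕ) ⟨2, rfl, ![a, b, c], ?_, ?_, ?_⟩
    · have : 2 ≤ 1 := by exact_mod_cast this
      omega
    · rw [Fin.strictMono_iff_lt_succ]
      intro i
      fin_cases i
      · simpa using hab
      · simpa using hbc
    · intro i
      fin_cases i
      · simpa using ha
      · simpa using hb
      · simpa using hc
    · intro i
      fin_cases i
      · simpa using hn.1
      · simpa using hn.2
  · rintro h k ⟨m, rfl, θ, hm, hd, hs⟩
    by_contra hk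
    have hm2 : 2 ≤ m := by
      by_contra h2
      exact hk (by exact_mod_cast (by omega : m ≤ 1))
    have h0 := hs ⟨0, by omega⟩
    have h1 := hs ⟨1, by omega⟩
    have := h (θ ⟨0, by omega⟩) (hd _) (θ ⟨1, by omega⟩) (hd _) (θ ⟨2, by omega⟩) (hd _)
      (hm (by simp [Fin.lt_def])) (hm (by simp [Fin.lt_def]))
    rcases this with h3 | h3
    · exact absurd h0 (not_lt.mpr h3)
    · exact absurd h1 (not_lt.mpr h3)

lemma lyapEval_continuous {τ : ℝ} {N : ℕ} (θ : ℝ) :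
    Continuous fun ψ : C(Set.Icc (-τ) (0 : ℝ), ℝ) × (Fin N → ℝ) => lyapEval ψ θ := by
  unfold lyapEval
  split_ifs with h h'
  · exact (continuous_eval_const (F := C(Set.Icc (-τ) (0 : ℝ), ℝ)) _).comp continuous_fst
  · exact (continuous_apply _).comp continuous_snd
  · exact continuous_const

lemma lyapV_closed (τ : ℝ) (N : ℕ) :
    IsClosed {ψ : C(Set.Icc (-τ) (0 : ℝ), ℝ) × (Fin N → ℝ) | lyapV ψ = 1} := by
  simp only [lyapV_eq_one_iff_sc, lyapSC_le_one_iff, Set.ofPred_forall]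
  refine isClosed_iInter fun a => isClosed_iInter fun _ => isClosed_iInter fun b =>
    isClosed_iInter fun _ => isClosed_iInter fun c => isClosed_iInter fun _ =>
    isClosed_iInter fun _ => isClosed_iInter fun _ => ?_
  exact (isClosed_le continuous_const ((lyapEval_continuous a).mul (lyapEval_continuous b))).union
    (isClosed_le continuous_const ((lyapEval_continuous b).mul (lyapEval_continuous c)))

lemma lyapV_of_nonneg {τ : ℝ} {N : ℕ}
    (ψ : C(Set.Icc (-τ) (0 : ℝ), ℝ) × (Fin N → ℝ)) (h1 : ∀ t, 0 ≤ ψ.1 t) (h2 : ∀ i, 0 ≤ ψ.2 i) :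
    lyapV ψ = 1 := by
  rw [lyapV_eq_one_iff_sc, lyapSC_le_one_iff]
  have h : ∀ θ, 0 ≤ lyapEval ψ θ := by
    intro θ
    unfold lyapEval
    split_ifs
    · exact h1 _
    · exact h2 _
    · exact le_rfl
  intro a _ b _ c _ _ _
  exact Or.inl (mul_nonneg (h a) (h b))

/-- With `Σ := {ψ ∈ 𝕏 ∖ {0} : V(ψ) = 1}`, the closure of `Σ` in `𝕏` equals
`Σ ∪ {0}`. -/
theorem stmt_6 (τ : ℝ) (hτ : 0 < τ) (N : ℕ) :
    closure {ψ : C(Set.Icc (-τ) (0 : ℝ), ℝ) × (Fin N → ℝ) | ψ ≠ 0 ∧ lyapV ψ = 1} =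
      {ψ : C(Set.Icc (-τ) (0 : ℝ), ℝ) × (Fin N → ℝ) | ψ ≠ 0 ∧ lyapV ψ = 1} ∪ {0} := by
  apply Set.Subset.antisymm
  · intro ψ hψ
    have h : lyapV ψ = 1 := closure_minimal (fun x hx => hx.2) (lyapV_closed τ N) hψ
    by_cases h0 : ψ = 0
    · exact Or.inr h0
    · exact Or.inl ⟨h0, h⟩
  · refine Set.union_subset subset_closure ?_
    rintro _ rfl
    let u : C(Set.Icc (-τ) (0 : ℝ), ℝ) × (Fin N → ℝ) := (ContinuousMap.const _ 1, fun _ => 1)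
    have ht : Filter.Tendsto (fun n : ℕ => (1 / ((n : ℝ) + 1)) • u) Filter.atTop (nhds 0) := by
      have := (tendsto_one_div_add_atTop_nhds_zero_nat (𝕜 := ℝ)).smul_const u
      rwa [zero_smul] at this
    refine mem_closure_of_tendsto ht (Filter.Eventually.of_forall fun n => ?_)
    have hp : 0 < 1 / ((n : ℝ) + 1) := by positivity
    refine ⟨fun h => ?_, lyapV_of_nonneg _ (fun t => ?_) (fun i => ?_)⟩
    · have h2 := congrArg (fun ψ : C(Set.Icc (-τ) (0 : ℝ), ℝ) × (Fin N → ℝ) =>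
        ψ.1 ⟨0, by simp [hτ.le]⟩) h
      have h3 : 1 / ((n : ℝ) + 1) * 1 = 0 := h2
      linarith
    · show 0 ≤ 1 / ((n : ℝ) + 1) * 1
      linarith
    · show 0 ≤ 1 / ((n : ℝ) + 1) * 1
      linarith
end

section
/- Let N ∈ ℕ and let J be an odd positive integer. Set φ := π/(2(N+1)), ω := π(J − 1/2), c := cos φ, s := sin φ, and for j = 0, 1, …, N define x_j : ℝ → ℝ by x_j(t) := cos(ωt + jφ). Then for all t ∈ ℝ: x_j'(t) = ω·(−(c/s)·x_j(t) + (1/s)·x_{j+1}(t)) for every j with 0 ≤ j ≤ N−1, and x_N'(t) = ω·(−(c/s)·x_N(t) − (1/s)·x₀(t−1)). -/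
/-- With `φ = π/(2(N+1))`, `ω = π(J − 1/2)` (`J` odd), `c = cos φ`, `s = sin φ`, and
`x_j(t) = cos(ωt + jφ)` for `j = 0,…,N`, one has
`x_j' = ω(−(c/s)x_j + (1/s)x_{j+1})` for `0 ≤ j ≤ N−1` and
`x_N'(t) = ω(−(c/s)x_N(t) − (1/s)x₀(t−1))`. -/
theorem stmt_8 (N J : ℕ) (hJodd : Odd J) (hJpos : 0 < J)
    (φ ω c s : ℝ)
    (hφ : φ = Real.pi / (2 * (N + 1)))
    (hω : ω = Real.pi * ((J : ℝ) - 1 / 2))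
    (hc : c = Real.cos φ) (hs : s = Real.sin φ)
    (x : ℕ → ℝ → ℝ) (hx : ∀ j t, x j t = Real.cos (ω * t + j * φ)) :
    (∀ t : ℝ, ∀ j : ℕ, j + 1 ≤ N →
      HasDerivAt (x j) (ω * (-(c / s) * x j t + (1 / s) * x (j + 1) t)) t) ∧
    (∀ t : ℝ,
      HasDerivAt (x N) (ω * (-(c / s) * x N t - (1 / s) * x 0 (t - 1))) t) := by
  have hN : (0 : ℝ) < (N : ℝ) + 1 := by positivity
  have hspos : 0 < s := by
    rw [hs]
    apply Real.sin_pos_of_pos_of_lt_pi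
    · rw [hφ]
      have := Real.pi_pos
      positivity
    · rw [hφ, div_lt_iff₀ (by positivity)]
      have hN0 : (0 : ℝ) ≤ (N : ℝ) := by positivity
      nlinarith [Real.pi_pos, mul_nonneg Real.pi_pos.le hN0]
  have key : ∀ t : ℝ, ∀ j : ℕ,
      HasDerivAt (x j) (ω * (-(c / s) * x j t + (1 / s) * x (j + 1) t)) t := by
    intro t j
    have hfun : x j = fun t => Real.cos (ω * t + j * φ) := funext (hx j)
    have hd : HasDerivAt (x j) (-Real.sin (ω * t + j * φ) * (ω * 1)) t := by
      rw [hfun]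
      exact (((hasDerivAt_id t).const_mul ω).add_const (j * φ)).cos
    convert hd using 1
    have h1 : x (j + 1) t = Real.cos (ω * t + j * φ) * c - Real.sin (ω * t + j * φ) * s := by
      rw [hx, hc, hs, ← Real.cos_add]
      congr 1
      push_cast
      ring
    rw [h1, hx]
    field_simp
    ring
  refine ⟨fun t j _ => key t j, fun t => ?_⟩
  convert key t N using 1
  have h2 : x 0 (t - 1) = - x (N + 1) t := by
    obtain ⟨k, rfl⟩ := hJodd
    have e1 : ω * t + ((N + 1 : ℕ) : ℝ) * φ
        = (ω * (t - 1) + ((0 : ℕ) : ℝ) * φ) + Real.pi + (k : ℝ) * (2 * Real.pi) := by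
      have h3 : ((N : ℝ) + 1) * φ = Real.pi / 2 := by
        rw [hφ]
        field_simp
      push_cast
      rw [h3, hω]
      push_cast
      ring
    rw [hx, hx, e1, Real.cos_add_nat_mul_two_pi, Real.cos_add_pi, neg_neg]
  rw [h2]
  ring
end

section
/- (Invariance) If a solution x of the unidirectional cyclic system satisfies x₁(s) ∈ I₁ for all s ∈ [−τ, 0] and x_j(0) ∈ I_j for j = 2,…,N, then x₁(t) ∈ I₁ and x_j(t) ∈ I_j for j = 2,…,N, for all t ≥ 0. (Attraction) For every solution x of the system there exists t₀ ≥ 0 such that x₁(t) ∈ I₁ and x_j(t) ∈ I_j for j = 2,…,N, for all t ≥ t₀. -/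
open Set Filter Topology

lemma aux_upper {f h : ℝ → ℝ} {m : ℝ} (hm : 0 < m)
    (hf : ∀ t, 0 ≤ t → HasDerivWithinAt f (m * (h t - f t)) (Ici 0) t)
    {T t B : ℝ} (hT : 0 ≤ T) (hTt : T ≤ t) (hB : ∀ s ∈ Icc T t, h s ≤ B) :
    f t - B ≤ (f T - B) * Real.exp (-(m * (t - T))) := by
  have key : AntitoneOn (fun s => (f s - B) * Real.exp (m * (s - T))) (Icc T t) := by
    have hd : ∀ s ∈ Icc T t, HasDerivWithinAt (fun s => (f s - B) * Real.exp (m * (s - T)))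
        ((m * (h s - f s)) * Real.exp (m * (s - T))
          + (f s - B) * (Real.exp (m * (s - T)) * (m * 1))) (Icc T t) s := by
      intro s hs
      have h1 := ((hf s (hT.trans hs.1)).mono
        (fun y hy => hT.trans hy.1 : Icc T t ⊆ Ici 0)).sub_const B
      have h2 : HasDerivAt (fun s => Real.exp (m * (s - T)))
          (Real.exp (m * (s - T)) * (m * 1)) s :=
        (((hasDerivAt_id s).sub_const T).const_mul m).exp
      exact h1.mul h2.hasDerivWithinAt
    refine antitoneOn_of_hasDerivWithinAt_nonpos (convex_Icc T t)
      (fun s hs => (hd s hs).continuousWithinAt)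
      (fun s hs => (hd s (interior_subset hs)).mono interior_subset) ?_
    intro s hs
    have := hB s (interior_subset hs)
    have he := Real.exp_pos (m * (s - T))
    have : (m * (h s - f s)) * Real.exp (m * (s - T))
          + (f s - B) * (Real.exp (m * (s - T)) * (m * 1))
        = (m * Real.exp (m * (s - T))) * (h s - B) := by ring
    rw [this]
    exact mul_nonpos_of_nonneg_of_nonpos (by positivity) (by linarith)
  have h3 := key (left_mem_Icc.2 hTt) (right_mem_Icc.2 hTt) hTt
  simp only [sub_self, mul_zero, Real.exp_zero, mul_one] at h3
  rw [Real.exp_neg, ← div_eq_mul_inv, le_div_iff₀ (Real.exp_pos _)]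
  exact h3

lemma aux_neg {f h : ℝ → ℝ} {m : ℝ}
    (hf : ∀ t, 0 ≤ t → HasDerivWithinAt f (m * (h t - f t)) (Ici 0) t) :
    ∀ t, 0 ≤ t → HasDerivWithinAt (fun t => - f t) (m * ((fun t => - h t) t - (fun t => - f t) t))
      (Ici 0) t := by
  intro t ht
  have := (hf t ht).neg
  have e : m * ((fun t => - h t) t - (fun t => - f t) t) = -(m * (h t - f t)) := by
    simp only []; ring
  rw [e]
  exact this

lemma aux_inv_up {f h : ℝ → ℝ} {m : ℝ} (hm : 0 < m)
    (hf : ∀ t, 0 ≤ t → HasDerivWithinAt f (m * (h t - f t)) (Ici 0) t)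
    {t B : ℝ} (hTt : 0 ≤ t) (hB : ∀ s ∈ Icc 0 t, h s ≤ B) (h0 : f 0 ≤ B) : f t ≤ B := by
  have h1 := aux_upper hm hf le_rfl hTt hB
  have : (f 0 - B) * Real.exp (-(m * (t - 0))) ≤ 0 :=
    mul_nonpos_of_nonpos_of_nonneg (by linarith) (Real.exp_pos _).le
  linarith

lemma aux_inv {f h : ℝ → ℝ} {m : ℝ} (hm : 0 < m)
    (hf : ∀ t, 0 ≤ t → HasDerivWithinAt f (m * (h t - f t)) (Ici 0) t)
    {J : Set ℝ} (hJc : IsCompact J) (hJ : IsPreconnected J)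
    {t : ℝ} (hTt : 0 ≤ t) (hB : ∀ s ∈ Icc 0 t, h s ∈ J) (h0 : f 0 ∈ J) : f t ∈ J := by
  have hJe : J = Icc (sInf J) (sSup J) := eq_Icc_of_connected_compact ⟨⟨_, h0⟩, hJ⟩ hJc
  generalize sInf J = p at hJe
  generalize sSup J = q at hJe
  subst hJe
  refine ⟨?_, aux_inv_up hm hf hTt (fun s hs => (hB s hs).2) h0.2⟩
  have := aux_inv_up (B := -p) hm (aux_neg hf) hTt (fun s hs => neg_le_neg (hB s hs).1)
    (neg_le_neg h0.1)
  simpa using this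

lemma aux_att_up {f h : ℝ → ℝ} {m : ℝ} (hm : 0 < m)
    (hf : ∀ t, 0 ≤ t → HasDerivWithinAt f (m * (h t - f t)) (Ici 0) t)
    {B B' : ℝ} (hBB : B < B') (hB : ∀ᶠ s in atTop, h s ≤ B) : ∀ᶠ t in atTop, f t ≤ B' := by
  obtain ⟨T, hT⟩ := eventually_atTop.1 (hB.and (eventually_ge_atTop 0))
  have hT0 : 0 ≤ T := (hT T le_rfl).2
  have hlim : Tendsto (fun t => (f T - B) * Real.exp (-(m * (t - T)))) atTop
      (𝓝 ((f T - B) * 0)) := by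
    refine Tendsto.const_mul _ (Real.tendsto_exp_neg_atTop_nhds_zero.comp ?_)
    exact (tendsto_atTop_add_const_right _ (-T) tendsto_id).const_mul_atTop hm
  rw [mul_zero] at hlim
  filter_upwards [hlim.eventually (gt_mem_nhds (sub_pos.2 hBB)), eventually_ge_atTop T]
    with t h1 h2
  have := aux_upper hm hf hT0 h2 (fun s hs => (hT s hs.1).1)
  linarith

def Inside (f : ℝ → ℝ) (U : Set ℝ) : Prop := ∃ K, IsCompact K ∧ K ⊆ U ∧ ∀ᶠ t in atTop, f t ∈ K

lemma aux_att {f h : ℝ → ℝ} {m : ℝ} (hm : 0 < m)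
    (hf : ∀ t, 0 ≤ t → HasDerivWithinAt f (m * (h t - f t)) (Ici 0) t)
    {V : Set ℝ} (hV : IsOpen V) (hVc : IsPreconnected V) (hin : Inside h V) : Inside f V := by
  obtain ⟨K, hK, hKV, hev⟩ := hin
  obtain ⟨t, ht⟩ := hev.exists
  have hne : K.Nonempty := ⟨_, ht⟩
  have hp := hKV (hK.sInf_mem hne)
  have hq := hKV (hK.sSup_mem hne)
  obtain ⟨p', hp', hp'V⟩ : ∃ p' < sInf K, p' ∈ V := by
    have h1 : ∀ᶠ y in 𝓝[<] (sInf K), y ∈ V := mem_nhdsWithin_of_mem_nhds (hV.mem_nhds hp)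
    obtain ⟨y, hy, hy'⟩ := (h1.and self_mem_nhdsWithin).exists
    exact ⟨y, hy', hy⟩
  obtain ⟨q', hq', hq'V⟩ : ∃ q' > sSup K, q' ∈ V := by
    have h1 : ∀ᶠ y in 𝓝[>] (sSup K), y ∈ V := mem_nhdsWithin_of_mem_nhds (hV.mem_nhds hq)
    obtain ⟨y, hy, hy'⟩ := (h1.and self_mem_nhdsWithin).exists
    exact ⟨y, hy', hy⟩
  refine ⟨Icc p' q', isCompact_Icc, hVc.ordConnected.out hp'V hq'V, ?_⟩
  have e1 := aux_att_up hm hf hq' (hev.mono fun t ht => le_csSup hK.bddAbove ht)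
  have e2 := aux_att_up hm (aux_neg hf) (neg_lt_neg hp')
    (hev.mono fun t ht => neg_le_neg (csInf_le hK.bddBelow ht))
  filter_upwards [e1, e2] with t h1 h2
  exact ⟨by linarith, h1⟩

lemma Inside.image {f φ : ℝ → ℝ} {U V : Set ℝ} (h : Inside f U) (hφ : Continuous φ)
    (hUV : ∀ y ∈ U, φ y ∈ V) : Inside (fun t => φ (f t)) V := by
  obtain ⟨K, hK, hKV, hev⟩ := h
  refine ⟨φ '' K, hK.image hφ, ?_, hev.mono fun t ht => ⟨_, ht, rfl⟩⟩
  rintro _ ⟨y, hy, rfl⟩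
  exact hUV y (hKV hy)

lemma Inside.shift {f : ℝ → ℝ} {U : Set ℝ} (h : Inside f U) (c : ℝ) :
    Inside (fun t => f (t - c)) U := by
  obtain ⟨K, hK, hKV, hev⟩ := h
  exact ⟨K, hK, hKV, (tendsto_atTop_add_const_right _ (-c) tendsto_id).eventually hev⟩

lemma fin_desc {N : ℕ} [NeZero N] (hN : 2 ≤ N) {L : Fin N} (hL : (L : ℕ) + 1 = N)
    (P : Fin N → Prop) (hlast : P L)
    (hstep : ∀ j : Fin N, (j : ℕ) + 1 < N → P (j + 1) → P j) : ∀ j, P j := by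
  have : ∀ k : ℕ, ∀ j : Fin N, (j : ℕ) + k + 1 = N → P j := by
    intro k
    induction k with
    | zero =>
      intro j hj
      have : j = L := Fin.ext (by omega)
      rw [this]; exact hlast
    | succ k ih =>
      intro j hj
      refine hstep j (by omega) (ih _ ?_)
      have : ((j + 1 : Fin N) : ℕ) = j + 1 := by
        rw [Fin.val_add, Fin.val_one', Nat.mod_eq_of_lt (by omega : 1 < N),
          Nat.mod_eq_of_lt (by omega)]
      omega
  intro j
  exact this (N - 1 - j) j (by omega)


/-- Invariance and attraction of the box `I₁ × … × I_N` for the unidirectional cyclic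
negative-feedback system `ẋ_j = −μ_j x_j + g_j(x_{j+1})` (`j = 1,…,N−1`),
`ẋ_N = −μ_N x_N + g_N(x₁(t−τ))`.  Indices are `Fin N` (so index `0` corresponds to
`x₁` and `j + 1` is cyclic); the delay `τ` enters only in the last equation, encoded
by the `if` in the derivative hypothesis.  Here `G_j = g_j/μ_j`,
`G = G₁ ∘ … ∘ G_N`, `I₁ = closure (G(ℝ))`, `I_N = G_N(I₁)` and `I_j = G_j(I_{j+1})`
for `j = 2,…,N−1` (the last two cases are encoded cyclically by `hIj`).

(Invariance) A solution starting in the box stays in it for all `t ≥ 0`.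
(Attraction) Every solution eventually enters the box. -/
theorem stmt_10 (N : ℕ) [NeZero N] (hN : 2 ≤ N) (τ : ℝ) (hτ : 0 < τ)
    (μ : Fin N → ℝ) (hμ : ∀ j, 0 < μ j)
    (g g' : Fin N → ℝ → ℝ)
    (hg0 : ∀ j, g j 0 = 0)
    (hgderiv : ∀ j y, HasDerivAt (g j) (g' j y) y)
    (hg'cont : ∀ j, Continuous (g' j))
    (hg'pos : ∀ j : Fin N, (j : ℕ) + 1 < N → ∀ y, 0 < g' j y)
    (hg'neg : ∀ y, g' ⟨N - 1, by omega⟩ y < 0)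
    (hgNbdd : ∃ M : ℝ, ∀ y, |g ⟨N - 1, by omega⟩ y| ≤ M)
    (G : ℝ → ℝ)
    (hG : G = (List.ofFn fun j : Fin N => fun y : ℝ => g j y / μ j).foldr (· ∘ ·) id)
    (I : Fin N → Set ℝ)
    (hI1 : I 0 = closure (Set.range G))
    (hIj : ∀ j : Fin N, j ≠ 0 → I j = (fun y => g j y / μ j) '' I (j + 1)) :
    (∀ x : ℝ → Fin N → ℝ,
      ContinuousOn x (Set.Ici (-τ)) →
      (∀ t ∈ Set.Ici (0 : ℝ), ∀ j : Fin N,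
        HasDerivWithinAt (fun s => x s j)
          (-μ j * x t j + g j (x (t - if (j : ℕ) + 1 = N then τ else 0) (j + 1)))
          (Set.Ici 0) t) →
      (∀ s ∈ Set.Icc (-τ) (0 : ℝ), x s 0 ∈ I 0) →
      (∀ j : Fin N, j ≠ 0 → x 0 j ∈ I j) →
      ∀ t ∈ Set.Ici (0 : ℝ), ∀ j : Fin N, x t j ∈ I j) ∧
    (∀ x : ℝ → Fin N → ℝ,
      ContinuousOn x (Set.Ici (-τ)) →
      (∀ t ∈ Set.Ici (0 : ℝ), ∀ j : Fin N,
        HasDerivWithinAt (fun s => x s j)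
          (-μ j * x t j + g j (x (t - if (j : ℕ) + 1 = N then τ else 0) (j + 1)))
          (Set.Ici 0) t) →
      ∃ t₀ : ℝ, 0 ≤ t₀ ∧ ∀ t : ℝ, t₀ ≤ t → ∀ j : Fin N, x t j ∈ I j) := by

  set φ : Fin N → ℝ → ℝ := fun j y => g j y / μ j with hφ
  have hgc : ∀ j, Continuous (g j) := fun j =>
    continuous_iff_continuousAt.2 fun y => (hgderiv j y).continuousAt
  have hφc : ∀ j, Continuous (φ j) := fun j => (hgc j).div_const _
  have hval : ∀ j : Fin N, (j : ℕ) + 1 < N → ((j + 1 : Fin N) : ℕ) = j + 1 := by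
    intro j hj
    rw [Fin.val_add, Fin.val_one', Nat.mod_eq_of_lt (by omega : 1 < N),
      Nat.mod_eq_of_lt (by omega)]
  set L : Fin N := ⟨N - 1, by omega⟩ with hL
  have hLN : (L : ℕ) + 1 = N := by simp [hL]; omega
  have hL1 : L + 1 = 0 := by
    apply Fin.ext
    rw [Fin.val_add, Fin.val_one', Nat.mod_eq_of_lt (by omega : 1 < N), hL]
    simp [Nat.sub_add_cancel (by omega : 1 ≤ N)]
  have hLne : L ≠ 0 := by
    intro h
    have := congrArg Fin.val h
    simp [hL] at this
    omega
  have hlt : ∀ j : Fin N, (j : ℕ) + 1 ≠ N → (j : ℕ) + 1 < N := fun j hj => by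
    have := j.2; omega
  have hg'ne : ∀ j y, g' j y ≠ 0 := by
    intro j y
    by_cases hj : (j : ℕ) + 1 = N
    · have : j = L := Fin.ext (by simp [hL]; omega)
      rw [this]; exact (hg'neg y).ne
    · exact (hg'pos j (hlt j hj) y).ne'
  have hφo : ∀ j, IsOpenMap (φ j) := by
    intro j
    refine isOpenMap_of_hasStrictDerivAt (f' := fun y => g' j y / μ j) (fun y => ?_)
      (fun y => div_ne_zero (hg'ne j y) (hμ j).ne')
    exact (hasStrictDerivAt_of_hasDerivAt_of_continuousAt
      (Eventually.of_forall (hgderiv j)) (hg'cont j).continuousAt).div_const _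
  -- partial compositions
  obtain ⟨C, hC0, hCN, hCs⟩ : ∃ C : ℕ → ℝ → ℝ, C 0 = G ∧ C N = id ∧
      ∀ j : Fin N, C j = φ j ∘ C (j + 1) := by
    refine ⟨fun k => ((List.ofFn φ).drop k).foldr (· ∘ ·) id, ?_, ?_, ?_⟩
    · simp [hG]
    · have : (List.ofFn φ).drop N = [] := List.drop_eq_nil_of_le (by simp)
      simp only [this, List.foldr_nil]
    · intro j
      have : (List.ofFn φ).drop j = φ j :: (List.ofFn φ).drop (j + 1) := by
        rw [List.drop_eq_getElem_cons (by simp)]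
        simp
      simp only [this, List.foldr_cons]
  have hCs1 : ∀ j : Fin N, (j : ℕ) + 1 < N → C j = φ j ∘ C ((j + 1 : Fin N) : ℕ) := by
    intro j hj
    rw [hval j hj]; exact hCs j
  have hCL : C L = φ L := by
    have := hCs L
    have e : (L : ℕ) + 1 = N := by simp [hL]; omega
    rw [e, hCN] at this
    simpa using this
  have hCc : ∀ j : Fin N, Continuous (C j) := by
    refine fin_desc hN hLN _ (by rw [hCL]; exact hφc L) ?_
    intro j hj h
    rw [hCs1 j hj]; exact (hφc j).comp h
  have hCo : ∀ j : Fin N, IsOpenMap (C j) := by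
    refine fin_desc hN hLN _ (by rw [hCL]; exact hφo L) ?_
    intro j hj h
    rw [hCs1 j hj]; exact (hφo j).comp h
  obtain ⟨M, hM⟩ := hgNbdd
  have hφL : ∀ y, φ L y ∈ Icc (-M / μ L) (M / μ L) := by
    intro y
    have h1 := abs_le.1 (hM y)
    exact ⟨div_le_div_of_nonneg_right h1.1 (hμ L).le, div_le_div_of_nonneg_right h1.2 (hμ L).le⟩
  have hCb : ∀ j : Fin N, ∃ K, IsCompact K ∧ ∀ y, C j y ∈ K := by
    refine fin_desc hN hLN _ ⟨_, isCompact_Icc, by rw [hCL]; exact hφL⟩ ?_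
    rintro j hj ⟨K, hK, h⟩
    refine ⟨φ j '' K, hK.image (hφc j), fun y => ?_⟩
    rw [hCs1 j hj]; exact ⟨_, h y, rfl⟩
  have hC0' : C ((0 : Fin N) : ℕ) = G := by simpa using hC0
  have hGc : Continuous G := hC0' ▸ hCc 0
  have hI0c : IsCompact (I 0) := by
    obtain ⟨K, hK, h⟩ := hCb 0
    rw [hI1]
    refine hK.of_isClosed_subset isClosed_closure (closure_minimal ?_ hK.isClosed)
    rintro _ ⟨y, rfl⟩
    rw [← hC0']; exact h y
  have hI0p : IsPreconnected (I 0) := by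
    rw [hI1]; exact (isPreconnected_range hGc).closure
  have hIC : ∀ j : Fin N, j ≠ 0 → I j = C j '' I 0 := by
    refine fin_desc hN hLN _ (fun _ => ?_) ?_
    · rw [hCL, hIj L hLne, hL1]
    · intro j hj h hj0
      have hne : j + 1 ≠ 0 := by
        intro h0
        have := congrArg Fin.val h0
        rw [hval j hj] at this
        simp at this
      rw [hCs1 j hj, hIj j hj0, h hne, Set.image_comp]
  have hGI : ∀ y, G y ∈ I 0 := fun y => hI1 ▸ subset_closure ⟨y, rfl⟩
  -- the closed box sets, with `C j '' I 0 ⊆ I j` for all `j`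
  have hCI : ∀ j : Fin N, ∀ y ∈ I 0, C j y ∈ I j := by
    intro j y hy
    by_cases hj : j = 0
    · subst hj; rw [hC0']; exact hGI y
    · rw [hIC j hj]; exact ⟨y, hy, rfl⟩
  have hIc : ∀ j, IsCompact (I j) := by
    intro j
    by_cases hj : j = 0
    · subst hj; exact hI0c
    · rw [hIC j hj]; exact hI0c.image (hCc j)
  have hIp : ∀ j, IsPreconnected (I j) := by
    intro j
    by_cases hj : j = 0
    · subst hj; exact hI0p
    · rw [hIC j hj]; exact hI0p.image _ (hCc j).continuousOn
  have hφI : ∀ j : Fin N, ∀ y ∈ I (j + 1), φ j y ∈ I j := by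
    intro j y hy
    by_cases hj : j = 0
    · subst hj
      have h0 : ((0 : Fin N) : ℕ) + 1 < N := by simp; omega
      have hne : (0 : Fin N) + 1 ≠ 0 := by
        intro h0'
        have := congrArg Fin.val h0'
        rw [hval 0 h0] at this
        simp at this
      rw [hIC _ hne] at hy
      obtain ⟨z, hz, rfl⟩ := hy
      have : φ 0 (C ((0 + 1 : Fin N) : ℕ) z) = G z := by
        rw [← hC0', hCs1 0 h0]; rfl
      rw [this]; exact hGI z
    · rw [hIj j hj]; exact ⟨y, hy, rfl⟩
  have hode : ∀ x : ℝ → Fin N → ℝ, (∀ t ∈ Set.Ici (0 : ℝ), ∀ j : Fin N,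
        HasDerivWithinAt (fun s => x s j)
          (-μ j * x t j + g j (x (t - if (j : ℕ) + 1 = N then τ else 0) (j + 1)))
          (Set.Ici 0) t) → ∀ j : Fin N, ∀ t, 0 ≤ t → HasDerivWithinAt (fun s => x s j)
          (μ j * ((fun t => φ j (x (t - if (j : ℕ) + 1 = N then τ else 0) (j + 1))) t
            - (fun s => x s j) t)) (Ici 0) t := by
    intro x hx j t ht
    convert hx t ht j using 1
    have := (hμ j).ne'
    simp only [hφ]
    field_simp
    ring
  refine ⟨?_, ?_⟩
  · intro x _ hx hinit0 hinit
    have hx' := hode x hx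
    have hstart : ∀ j, x 0 j ∈ I j := by
      intro j
      by_cases hj : j = 0
      · subst hj; exact hinit0 0 ⟨by linarith, le_rfl⟩
      · exact hinit j hj
    have step : ∀ T : ℝ, (∀ s, -τ ≤ s → s ≤ T - τ → x s 0 ∈ I 0) →
        ∀ j, ∀ t, 0 ≤ t → t ≤ T → x t j ∈ I j := by
      intro T hT
      refine fin_desc hN hLN _ ?_ ?_
      · intro t ht htT
        refine aux_inv (hμ L) (hx' L) (hIc L) (hIp L) ht ?_ (hstart L)
        intro s hs
        refine hφI L _ ?_
        rw [if_pos hLN, hL1]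
        exact hT _ (by linarith [hs.1]) (by linarith [hs.2])
      · intro j hj ih t ht htT
        refine aux_inv (hμ j) (hx' j) (hIc j) (hIp j) ht ?_ (hstart j)
        intro s hs
        refine hφI j _ ?_
        rw [if_neg hj.ne, sub_zero]
        exact ih s hs.1 (hs.2.trans htT)
    have main : ∀ n : ℕ, ∀ s, -τ ≤ s → s ≤ n * τ → x s 0 ∈ I 0 := by
      intro n
      induction n with
      | zero => intro s h1 h2; exact hinit0 s ⟨h1, by simpa using h2⟩
      | succ n ih =>
        intro s h1 h2
        by_cases hs : s ≤ 0
        · exact hinit0 s ⟨h1, hs⟩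
        · refine step ((n + 1 : ℕ) * τ) (fun r hr hr' => ih r hr ?_) 0 s (by linarith) h2
          push_cast at hr'
          linarith
    intro t ht j
    obtain ⟨n, hn⟩ := exists_nat_ge (t / τ)
    have : t ≤ n * τ := (div_le_iff₀ hτ).1 hn
    exact step t (fun s h1 h2 => main n s h1 (by linarith)) j t ht le_rfl
  · intro x _ hx
    have hx' := hode x hx
    have round : ∀ V : Fin N → Set ℝ, (∀ j, IsOpen (V j)) → (∀ j, IsPreconnected (V j)) →
        (∀ j : Fin N, (j : ℕ) + 1 < N → ∀ y ∈ V (j + 1), φ j y ∈ V j) →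
        Inside (fun t => φ L (x (t - τ) 0)) (V L) → ∀ j, Inside (fun t => x t j) (V j) := by
      intro V hVo hVp hVs hstart
      refine fin_desc hN hLN _ ?_ ?_
      · refine aux_att (hμ L) (hx' L) (hVo L) (hVp L) ?_
        rw [if_pos hLN, hL1]
        exact hstart
      · intro j hj ih
        refine aux_att (hμ j) (hx' j) (hVo j) (hVp j) ?_
        rw [if_neg hj.ne]
        simp only [sub_zero]
        exact ih.image (hφc j) (hVs j hj)
    have r0 := round (fun _ => univ) (fun _ => isOpen_univ) (fun _ => isPreconnected_univ)
      (fun _ _ _ _ => trivial)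
      ⟨_, isCompact_Icc, subset_univ _, Eventually.of_forall fun t => hφL _⟩
    have roundS : ∀ S : Set ℝ, IsOpen S → IsPreconnected S → Inside (fun t => x t 0) S →
        ∀ j, Inside (fun t => x t j) (C j '' S) := by
      intro S hS hSp h0
      refine round (fun j => C j '' S) (fun j => hCo j S hS)
        (fun j => hSp.image _ (hCc j).continuousOn) ?_ ?_
      · rintro j hj _ ⟨z, hz, rfl⟩
        exact ⟨z, hz, by rw [hCs1 j hj]; rfl⟩
      · rw [hCL]
        exact (h0.shift τ).image (hφc L) (fun y hy => ⟨y, hy, rfl⟩)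
    have r1 := roundS univ isOpen_univ isPreconnected_univ (r0 0) 0
    have r2 := roundS _ (hCo 0 _ isOpen_univ)
      (isPreconnected_univ.image _ (hCc 0).continuousOn) r1
    have r3 : ∀ᶠ t in atTop, ∀ j, x t j ∈ I j := by
      rw [eventually_all]
      intro j
      obtain ⟨K, _, hK, hev⟩ := r2 j
      filter_upwards [hev] with t ht
      obtain ⟨z, ⟨w, -, rfl⟩, hz⟩ := hK ht
      rw [← hz]
      refine hCI j _ ?_
      rw [hC0']; exact hGI w
    obtain ⟨T, hT⟩ := eventually_atTop.1 (r3.and (eventually_ge_atTop 0))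
    exact ⟨T, (hT T le_rfl).2, fun t ht => (hT t ht).1⟩
end

section
/- There exists K_c ≥ 0 such that for every K ≥ 0 the equation χ_K(x) = 0 has a real solution if and only if K ≤ K_c. Moreover, for every K > 0 every real solution x of χ_K(x) = 0 satisfies x < 0. -/
/-- For the characteristic function `χ_K(x) = ∏_{j} (x + μ_j) + K·e^{−xτ}` (with
`μ_j > 0`, `τ > 0`), there exists `K_c ≥ 0` such that for every `K ≥ 0` the equation
`χ_K(x) = 0` has a real solution iff `K ≤ K_c`; moreover for `K > 0` every real
solution is negative. -/
theorem stmt_11 (N : ℕ) (hN : 1 ≤ N) (μ : Fin N → ℝ) (hμ : ∀ j, 0 < μ j)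
    (τ : ℝ) (hτ : 0 < τ) :
    ∃ Kc : ℝ, 0 ≤ Kc ∧
      (∀ K : ℝ, 0 ≤ K →
        ((∃ x : ℝ, (∏ j, (x + μ j)) + K * Real.exp (-x * τ) = 0) ↔ K ≤ Kc)) ∧
      (∀ K : ℝ, 0 < K → ∀ x : ℝ,
        (∏ j, (x + μ j)) + K * Real.exp (-x * τ) = 0 → x < 0) := by
  have key : ∀ K x : ℝ, (∏ j, (x + μ j)) + K * Real.exp (-x * τ) = 0 ↔
      -(∏ j, (x + μ j)) * Real.exp (x * τ) = K := by
    intro K x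
    have h1 : Real.exp (-x * τ) * Real.exp (x * τ) = 1 := by
      rw [← Real.exp_add]; simp
    constructor
    · intro h
      linear_combination (-Real.exp (x * τ)) * h + K * h1
    · intro h
      rw [← h]
      linear_combination (-(∏ j, (x + μ j))) * h1
  simp only [key]
  set g : ℝ → ℝ := fun x => -(∏ j, (x + μ j)) * Real.exp (x * τ) with hg
  have hgc : Continuous g := by
    rw [hg]; fun_prop
  have hneg : ∀ x : ℝ, 0 ≤ x → g x < 0 := by
    intro x hx
    have h1 : 0 < ∏ j, (x + μ j) := Finset.prod_pos fun j _ => by linarith [hμ j]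
    have h2 := mul_pos h1 (Real.exp_pos (x * τ))
    simp only [hg]; linarith
  have hz : g (-μ ⟨0, hN⟩) = 0 := by
    have : ∏ j, (-μ ⟨0, hN⟩ + μ j) = 0 :=
      Finset.prod_eq_zero (Finset.mem_univ ⟨0, hN⟩) (by simp)
    simp [hg, this]
  have hlim : Filter.Tendsto g Filter.atBot (nhds 0) := by
    let p : Polynomial ℝ := -∏ j, (Polynomial.C (μ j) - Polynomial.C (1 / τ) * Polynomial.X)
    have h1 := Polynomial.tendsto_div_exp_atTop p
    have h2 : Filter.Tendsto (fun x : ℝ => -(x * τ)) Filter.atBot Filter.atTop :=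
      Filter.tendsto_neg_atBot_atTop.comp (Filter.tendsto_id.atBot_mul_const hτ)
    refine (h1.comp h2).congr fun x => ?_
    have h3 : p.eval (-(x * τ)) = -∏ j, (x + μ j) := by
      simp only [p, Polynomial.eval_neg, Polynomial.eval_prod]
      congr 1
      refine Finset.prod_congr rfl fun j _ => ?_
      simp only [Polynomial.eval_sub, Polynomial.eval_C, Polynomial.eval_mul, Polynomial.eval_X]
      field_simp
      ring
    simp only [Function.comp, h3, hg, Real.exp_neg, div_inv_eq_mul]
  have hmax : ∃ x₀, ∀ x, g x ≤ g x₀ := by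
    by_cases h : ∃ y, 0 < g y
    · obtain ⟨y, hy⟩ := h
      refine hgc.exists_forall_ge' y ?_
      rw [cocompact_eq_atBot_atTop, Filter.eventually_sup]
      refine ⟨?_, ?_⟩
      · filter_upwards [hlim.eventually (gt_mem_nhds hy)] with x hx using hx.le
      · filter_upwards [Filter.eventually_ge_atTop 0] with x hx
        linarith [hneg x hx]
    · push Not at h
      exact ⟨-μ ⟨0, hN⟩, fun x => by rw [hz]; exact h x⟩
  obtain ⟨x₀, hx₀⟩ := hmax
  refine ⟨g x₀, hz ▸ hx₀ _, ?_, ?_⟩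
  · intro K hK
    constructor
    · rintro ⟨x, rfl⟩
      exact hx₀ x
    · intro h
      exact mem_range_of_exists_le_of_exists_ge hgc ⟨_, hz.trans_le hK⟩ ⟨x₀, h⟩
  · intro K hK x hx
    by_contra hc
    have h1 := hneg x (not_lt.mp hc)
    have h2 : g x = K := hx
    linarith
end

section
/- There exists a unique ω ∈ (0, π/τ) such that π − ωτ = Σ_{j=1}^N arctan(ω/μ_j). -/
/-- For `μ_j > 0` and `τ > 0`, there exists a unique `ω ∈ (0, π/τ)` with
`π − ωτ = Σ_{j=1}^N arctan(ω/μ_j)`. -/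
theorem stmt_12 (N : ℕ) (hN : 1 ≤ N) (μ : Fin N → ℝ) (hμ : ∀ j, 0 < μ j)
    (τ : ℝ) (hτ : 0 < τ) :
    ∃! ω : ℝ, ω ∈ Set.Ioo 0 (Real.pi / τ) ∧
      Real.pi - ω * τ = ∑ j, Real.arctan (ω / μ j) := by
  have hb : 0 < Real.pi / τ := div_pos Real.pi_pos hτ
  have hbτ : Real.pi / τ * τ = Real.pi := div_mul_cancel₀ _ hτ.ne'
  have hmono : StrictMono (fun x : ℝ => x * τ + ∑ j, Real.arctan (x / μ j)) := by
    intro x y hxy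
    have h1 : x * τ < y * τ := mul_lt_mul_of_pos_right hxy hτ
    have h2 : ∑ j, Real.arctan (x / μ j) ≤ ∑ j, Real.arctan (y / μ j) :=
      Finset.sum_le_sum fun j _ =>
        Real.arctan_strictMono.monotone (div_le_div_of_nonneg_right hxy.le (hμ j).le)
    exact add_lt_add_of_lt_of_le h1 h2
  have hcont : Continuous (fun x : ℝ => x * τ + ∑ j, Real.arctan (x / μ j)) := by
    refine (continuous_id.mul continuous_const).add (continuous_finsetSum _ fun j _ => ?_)
    exact Real.continuous_arctan.comp (continuous_id.div_const _)
  have hpos : 0 < ∑ j, Real.arctan (Real.pi / τ / μ j) := by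
    apply Finset.sum_pos
    · intro j _
      exact Real.arctan_pos.mpr (div_pos hb (hμ j))
    · exact ⟨⟨0, hN⟩, Finset.mem_univ _⟩
  obtain ⟨ω, hω, he⟩ := intermediate_value_Ioo hb.le hcont.continuousOn
    (show Real.pi ∈ Set.Ioo _ _ from ⟨by simpa using Real.pi_pos, by
      show Real.pi < Real.pi / τ * τ + _
      linarith⟩)
  have he' : ω * τ + ∑ j, Real.arctan (ω / μ j) = Real.pi := he
  refine ⟨ω, ⟨hω, by linarith⟩, ?_⟩
  rintro y ⟨_, hy⟩
  apply hmono.injective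
  show y * τ + ∑ j, Real.arctan (y / μ j) = ω * τ + ∑ j, Real.arctan (ω / μ j)
  linarith
end

section
/- One has K_c = e^{−1−μτ}/τ and K_u > π/(2τ); consequently K_c < e^{−1}/τ < π/(2τ) < K_u, and in particular K_c < K_u. -/
/-- Scalar case `N = 1`: with `K_c` the oscillation border and `K_u = √(ω₁² + μ²)` the
stability border (where `ω₁` is the unique solution in `(0, π/τ)` of
`π − ωτ = arctan(ω/μ)`), one has `K_c = e^{−1−μτ}/τ`, `K_u > π/(2τ)`, and consequently
`K_c < e^{−1}/τ < π/(2τ) < K_u`; in particular `K_c < K_u`. -/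
theorem stmt_13 (μ τ : ℝ) (hμ : 0 < μ) (hτ : 0 < τ)
    (Kc : ℝ)
    (hKc : Kc = sSup {K : ℝ | 0 ≤ K ∧ ∃ x : ℝ, x + μ + K * Real.exp (-x * τ) = 0})
    (ω₁ : ℝ) (hω₁ : ω₁ ∈ Set.Ioo 0 (Real.pi / τ))
    (hω₁eq : Real.pi - ω₁ * τ = Real.arctan (ω₁ / μ))
    (Ku : ℝ) (hKu : Ku = Real.sqrt (ω₁ ^ 2 + μ ^ 2)) :
    Kc = Real.exp (-1 - μ * τ) / τ ∧
    Real.pi / (2 * τ) < Ku ∧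
    Kc < Real.exp (-1) / τ ∧
    Real.exp (-1) / τ < Real.pi / (2 * τ) ∧
    Kc < Ku := by
  have hc : Kc = Real.exp (-1 - μ * τ) / τ := by
    rw [hKc]
    apply IsGreatest.csSup_eq
    constructor
    · refine ⟨by positivity, -μ - 1 / τ, ?_⟩
      have h1 : -(-μ - 1 / τ) * τ = -(-1 - μ * τ) := by field_simp; ring
      have h2 : Real.exp (-1 - μ * τ) * Real.exp (-(-1 - μ * τ)) = 1 := by
        rw [← Real.exp_add, add_neg_cancel, Real.exp_zero]
      rw [h1, div_mul_eq_mul_div, h2]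
      ring
    · rintro K ⟨_, x, hx⟩
      rw [le_div_iff₀ hτ]
      have h1 := Real.add_one_le_exp (-(x + μ) * τ - 1)
      have h2 : Real.exp (-(x + μ) * τ - 1) = Real.exp (-1 - μ * τ) * Real.exp (-x * τ) := by
        rw [← Real.exp_add]; congr 1; ring
      have h3 := Real.exp_pos (-x * τ)
      rw [h2] at h1
      have h4 : -(x + μ) = K * Real.exp (-x * τ) := by linarith
      rw [h4] at h1
      refine le_of_mul_le_mul_right ?_ h3
      nlinarith
  have hu : Real.pi / (2 * τ) < Ku := by
    have h1 := Real.arctan_lt_pi_div_two (ω₁ / μ)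
    have h2 : Real.pi / (2 * τ) < ω₁ := by
      rw [div_lt_iff₀ (by positivity)]; linarith
    have h3 : ω₁ < Ku := by
      rw [hKu]
      apply Real.lt_sqrt_of_sq_lt
      have : 0 < μ ^ 2 := by positivity
      linarith
    exact h2.trans h3
  have h3 : Kc < Real.exp (-1) / τ := by
    rw [hc]
    apply div_lt_div_of_pos_right _ hτ
    apply Real.exp_lt_exp.mpr
    have : 0 < μ * τ := by positivity
    linarith
  have h4 : Real.exp (-1) / τ < Real.pi / (2 * τ) := by
    rw [← div_div]
    apply div_lt_div_of_pos_right _ hτ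
    have h5 : Real.exp (-1) < 1 := by rw [Real.exp_lt_one_iff]; norm_num
    have := Real.pi_gt_three
    linarith
  exact ⟨hc, hu, h3, h4, h3.trans (h4.trans hu)⟩
end

section
/- K_c < K_u, i.e. sup{K ≥ 0 : there exists x ∈ ℝ with (x+μ₁)(x+μ₂) + K·e^{−xτ} = 0} < √(ω₁² + μ₁²)·√(ω₁² + μ₂²). -/
lemma aux_K (a b τ K x : ℝ) (ha : 0 < a) (hab : a ≤ b) (hτ : 0 < τ) (hK : 0 ≤ K)
    (h : (x + a) * (x + b) + K * Real.exp (-x * τ) = 0) : K ≤ b / (2 * τ) := by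
  have hE := Real.exp_pos (-x * τ)
  have hKE : 0 ≤ K * Real.exp (-x * τ) := by positivity
  have hx : x < 0 := by
    by_contra hx
    push Not at hx
    have : 0 < (x + a) * (x + b) := by
      apply mul_pos <;> linarith
    linarith
  have h2 : 2 * (-x * τ) ≤ Real.exp (-x * τ) := by
    have h3 := Real.add_one_le_exp (-x * τ - 1)
    have h4 := Real.add_one_le_exp (1 : ℝ)
    have h5 : Real.exp (-x * τ) = Real.exp 1 * Real.exp (-x * τ - 1) := by
      rw [← Real.exp_add]; congr 1; ring
    have h6 : 0 < -x * τ := mul_pos (by linarith) hτ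
    rw [h5]
    exact mul_le_mul (by linarith) (by linarith) h6.le (by positivity)
  have h7 : K * Real.exp (-x * τ) ≤ -x * b := by
    rcases le_total (-x) a with h8 | h8 <;> nlinarith
  have h9 : K * (2 * (-x * τ)) ≤ -x * b := (mul_le_mul_of_nonneg_left h2 hK).trans h7
  rw [le_div_iff₀ (by positivity)]
  have : (-x) * (K * (2 * τ)) ≤ (-x) * b := by linarith
  exact le_of_mul_le_mul_left this (by linarith)

lemma aux_main (a b τ ω : ℝ) (ha : 0 < a) (hb : 0 < b) (hab : a ≤ b) (hτ : 0 < τ) (hω : 0 < ω)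
    (h : Real.pi - ω * τ = Real.arctan (ω / a) + Real.arctan (ω / b)) :
    b / (2 * τ) < Real.sqrt (ω ^ 2 + a ^ 2) * Real.sqrt (ω ^ 2 + b ^ 2) := by
  rw [← Real.sqrt_mul (by positivity)]
  apply Real.lt_sqrt_of_sq_lt
  have hθ : 0 < ω * τ := by positivity
  rcases le_total (1/2) (ω * τ) with h1 | h1
  · have h2 : b / (2 * τ) ≤ ω * b := by
      rw [div_le_iff₀ (by positivity)]
      nlinarith
    have h3 : (b / (2 * τ)) ^ 2 ≤ (ω * b) ^ 2 := pow_le_pow_left₀ (by positivity) h2 2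
    have : 0 < ω ^ 2 * ω ^ 2 := by positivity
    have : 0 < a ^ 2 * ω ^ 2 := by positivity
    have : 0 < a ^ 2 * b ^ 2 := by positivity
    nlinarith
  · have h2 : b / (2 * τ) ≤ ω ^ 2 := by
      have h3 := Real.arctan_lt_pi_div_two (ω / a)
      have h4 : Real.arctan (b / ω) = Real.pi / 2 - Real.arctan (ω / b) := by
        rw [← Real.arctan_inv_of_pos (by positivity), inv_div]
      have h5 : Real.arctan (b / ω) ≤ ω * τ := by linarith
      have hpi := Real.pi_gt_three
      have h6 : b / ω ≤ Real.tan (ω * τ) := by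
        rw [← Real.arctan_le_arctan_iff, Real.arctan_tan (by linarith) (by linarith)]
        exact h5
      have hc := Real.one_sub_sq_div_two_le_cos (x := ω * τ)
      have hc2 : 1 / 2 ≤ Real.cos (ω * τ) := by nlinarith
      have hs := Real.sin_le hθ.le
      have h7 : Real.tan (ω * τ) ≤ 2 * (ω * τ) := by
        rw [Real.tan_eq_sin_div_cos, div_le_iff₀ (by linarith)]
        nlinarith
      have h8 : b / ω ≤ 2 * (ω * τ) := h6.trans h7
      rw [div_le_iff₀ hω] at h8
      rw [div_le_iff₀ (by positivity)]
      linarith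
    have h3 : (b / (2 * τ)) ^ 2 ≤ (ω ^ 2) ^ 2 := pow_le_pow_left₀ (by positivity) h2 2
    have : 0 < b ^ 2 * ω ^ 2 := by positivity
    have : 0 < a ^ 2 * ω ^ 2 := by positivity
    have : 0 < a ^ 2 * b ^ 2 := by positivity
    nlinarith

/-- Case `N = 2`: the oscillation border is strictly below the stability border:
`K_c < K_u`, where `K_c = sup{K ≥ 0 : ∃ x ∈ ℝ, (x+μ₁)(x+μ₂) + K·e^{−xτ} = 0}` and
`K_u = √(ω₁² + μ₁²)·√(ω₁² + μ₂²)` with `ω₁` the unique number in `(0, π/τ)` satisfying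
`π − ω₁τ = arctan(ω₁/μ₁) + arctan(ω₁/μ₂)`. -/
theorem stmt_14 (μ₁ μ₂ τ : ℝ) (hμ₁ : 0 < μ₁) (hμ₂ : 0 < μ₂) (hτ : 0 < τ)
    (Kc : ℝ)
    (hKc : Kc = sSup {K : ℝ | 0 ≤ K ∧
      ∃ x : ℝ, (x + μ₁) * (x + μ₂) + K * Real.exp (-x * τ) = 0})
    (ω₁ : ℝ) (hω₁ : ω₁ ∈ Set.Ioo 0 (Real.pi / τ))
    (hω₁eq : Real.pi - ω₁ * τ = Real.arctan (ω₁ / μ₁) + Real.arctan (ω₁ / μ₂))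
    (Ku : ℝ) (hKu : Ku = Real.sqrt (ω₁ ^ 2 + μ₁ ^ 2) * Real.sqrt (ω₁ ^ 2 + μ₂ ^ 2)) :
    Kc < Ku := by
  subst hKc hKu
  rcases le_total μ₁ μ₂ with hab | hab
  · refine lt_of_le_of_lt (Real.sSup_le ?_ (by positivity))
      (aux_main μ₁ μ₂ τ ω₁ hμ₁ hμ₂ hab hτ hω₁.1 hω₁eq)
    rintro K ⟨hK, x, hx⟩
    exact aux_K μ₁ μ₂ τ K x hμ₁ hab hτ hK hx
  · rw [mul_comm (Real.sqrt _)]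
    refine lt_of_le_of_lt (Real.sSup_le ?_ (by positivity))
      (aux_main μ₂ μ₁ τ ω₁ hμ₂ hμ₁ hab hτ hω₁.1 (by linarith))
    rintro K ⟨hK, x, hx⟩
    exact aux_K μ₂ μ₁ τ K x hμ₂ hab hτ hK (by linarith)
end

section
/- For every N ≥ 3 there exists M ≥ 1 with the following properties, where the parameters are τ = 1 and μ_j = M for all j = 1,…,N: (i) for every K ≥ 1 and every x ∈ ℝ, (x + M)^N + K·e^{−x} ≠ 0, so that K_c := sup{K ≥ 0 : ∃ x ∈ ℝ, (x+M)^N + K·e^{−x} = 0} satisfies K_c < 1; (ii) the unique ω₁ ∈ (0, π) with π − ω₁ = N·arctan(ω₁/M) yields K_u := (ω₁² + M²)^{N/2} > M^N ≥ 1. In particular K_c < K_u for these parameters. -/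
/-- For every `N ≥ 3` there exists `M ≥ 1` such that, with parameters `τ = 1` and
`μ_j = M` for all `j`: (i) for every `K ≥ 1` the characteristic function
`(x+M)^N + K·e^{−x}` has no real zero, so the oscillation border
`K_c = sup{K ≥ 0 : ∃ x, (x+M)^N + K·e^{−x} = 0}` satisfies `K_c < 1`; (ii) the unique
`ω₁ ∈ (0, π)` with `π − ω₁ = N·arctan(ω₁/M)` yields a stability border
`K_u = (√(ω₁² + M²))^N > M^N ≥ 1`. In particular `K_c < K_u`. -/
theorem stmt_16 (N : ℕ) (hN : 3 ≤ N) :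
    ∃ M : ℝ, 1 ≤ M ∧
      (∀ K : ℝ, 1 ≤ K → ∀ x : ℝ, (x + M) ^ N + K * Real.exp (-x) ≠ 0) ∧
      sSup {K : ℝ | 0 ≤ K ∧ ∃ x : ℝ, (x + M) ^ N + K * Real.exp (-x) = 0} < 1 ∧
      (∃! ω₁ : ℝ, ω₁ ∈ Set.Ioo 0 Real.pi ∧
        Real.pi - ω₁ = N * Real.arctan (ω₁ / M)) ∧
      (∀ ω₁ : ℝ, ω₁ ∈ Set.Ioo 0 Real.pi →
        Real.pi - ω₁ = N * Real.arctan (ω₁ / M) →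
        M ^ N < Real.sqrt (ω₁ ^ 2 + M ^ 2) ^ N ∧ (1 : ℝ) ≤ M ^ N ∧
        sSup {K : ℝ | 0 ≤ K ∧ ∃ x : ℝ, (x + M) ^ N + K * Real.exp (-x) = 0} <
          Real.sqrt (ω₁ ^ 2 + M ^ 2) ^ N) := by
  have hM1 : (1 : ℝ) ≤ (N.factorial : ℝ) := by exact_mod_cast Nat.factorial_pos N
  generalize hM : (N.factorial : ℝ) = M at hM1
  have hM0 : 0 < M := by linarith
  have hc1 : M * Real.exp (-M) < 1 := by
    rw [Real.exp_neg, ← div_eq_mul_inv, div_lt_one (Real.exp_pos _)]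
    linarith [Real.add_one_le_exp M]
  have hc0 : 0 ≤ M * Real.exp (-M) := by positivity
  have key : ∀ K : ℝ, 0 ≤ K → ∀ x : ℝ, (x + M) ^ N + K * Real.exp (-x) = 0 →
      K ≤ M * Real.exp (-M) := by
    intro K hK x hx
    have hex := Real.exp_pos (-x)
    rcases le_or_gt 0 (x + M) with h | h
    · have h1 : 0 ≤ (x + M) ^ N := pow_nonneg h N
      have h2 : K ≤ 0 := by
        by_contra hcon
        push Not at hcon
        have := mul_pos hcon hex
        linarith
      linarith
    · have h1 : -(x + M) ^ N ≤ (-(x + M)) ^ N := by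
        have h3 : (-(x + M)) ^ N = |(x + M) ^ N| := by rw [abs_pow, abs_of_neg h]
        rw [h3]
        exact neg_le_abs _
      have h2 : (-(x + M)) ^ N ≤ M * Real.exp (-(x + M)) := by
        have := Real.pow_div_factorial_le_exp (-(x + M)) (by linarith) N
        rw [hM, div_le_iff₀ hM0] at this
        linarith
      have h4 : Real.exp (-(x + M)) = Real.exp (-M) * Real.exp (-x) := by
        rw [← Real.exp_add]
        ring_nf
      rw [h4] at h2
      refine le_of_mul_le_mul_right ?_ hex
      linarith
  have hsup : sSup {K : ℝ | 0 ≤ K ∧ ∃ x : ℝ, (x + M) ^ N + K * Real.exp (-x) = 0} < 1 := by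
    refine lt_of_le_of_lt (Real.sSup_le ?_ hc0) hc1
    rintro K ⟨hK, x, hx⟩
    exact key K hK x hx
  have hMN : (1 : ℝ) ≤ M ^ N := one_le_pow₀ hM1
  have hN0 : (0 : ℝ) < N := by
    have : 0 < N := by omega
    exact_mod_cast this
  have hmono : StrictMono (fun w : ℝ => w + N * Real.arctan (w / M)) := by
    intro a b hab
    have h1 : Real.arctan (a / M) < Real.arctan (b / M) :=
      Real.arctan_strictMono (div_lt_div_of_pos_right hab hM0)
    have h2 := mul_lt_mul_of_pos_left h1 hN0
    simp only
    linarith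
  refine ⟨M, hM1, ?_, hsup, ?_, ?_⟩
  · intro K hK x hx
    have := key K (by linarith) x hx
    linarith
  · have hcont : Continuous (fun w : ℝ => w + N * Real.arctan (w / M)) := by
      have := Real.continuous_arctan
      fun_prop
    have hpi := Real.pi_pos
    have hat : 0 < Real.arctan (Real.pi / M) := Real.arctan_pos.2 (by positivity)
    have hmem : Real.pi ∈ Set.Ioo ((0 : ℝ) + N * Real.arctan (0 / M))
        (Real.pi + N * Real.arctan (Real.pi / M)) := by
      constructor
      · simpa using hpi
      · have := mul_pos hN0 hat
        linarith
    obtain ⟨w, hw, hfw⟩ := intermediate_value_Ioo hpi.le hcont.continuousOn hmem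
    simp only at hfw
    refine ⟨w, ⟨hw, by linarith⟩, ?_⟩
    rintro v ⟨_, hv⟩
    apply hmono.injective
    simp only
    linarith
  · intro w hw _
    have hlt : M < Real.sqrt (w ^ 2 + M ^ 2) := by
      apply Real.lt_sqrt_of_sq_lt
      have := pow_pos hw.1 2
      linarith
    have hp : M ^ N < Real.sqrt (w ^ 2 + M ^ 2) ^ N :=
      pow_lt_pow_left₀ hlt hM0.le (by omega)
    exact ⟨hp, hMN, by linarith⟩
end

section
/- For every N ≥ 3 there exist τ > 0 and μ₁,…,μ_N > 0 such that K_u < K_c, i.e. the stability border is strictly smaller than the oscillation border: with ω₁ the unique number in (0, π/τ) satisfying π − ω₁τ = Σ_{j=1}^N arctan(ω₁/μ_j), one has ∏_{j=1}^N √(ω₁² + μ_j²) < sup{K ≥ 0 : there exists x ∈ ℝ with ∏_{j=1}^N (x+μ_j) + K·e^{−xτ} = 0}. -/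
lemma aux_unique (N : ℕ) (τ : ℝ) (μ : Fin N → ℝ) (hτ : 0 < τ) (hμ : ∀ j, 0 < μ j)
    (j0 : Fin N) :
    ∃! ω₁ : ℝ, ω₁ ∈ Set.Ioo 0 (Real.pi / τ) ∧
        Real.pi - ω₁ * τ = ∑ j, Real.arctan (ω₁ / μ j) := by
  set f : ℝ → ℝ := fun ω => ω * τ + ∑ j, Real.arctan (ω / μ j) with hf
  have hmono : StrictMono f := by
    intro a b hab
    have h1 : a * τ < b * τ := mul_lt_mul_of_pos_right hab hτ
    have h2 : ∑ j, Real.arctan (a / μ j) ≤ ∑ j, Real.arctan (b / μ j) := by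
      apply Finset.sum_le_sum
      intro j _
      exact Real.arctan_strictMono.monotone (div_le_div_of_nonneg_right hab.le (hμ j).le)
    simp only [hf]
    linarith
  have hcont : Continuous f := by
    simp only [hf]
    refine Continuous.add (by fun_prop) (continuous_finset_sum _ fun j _ => ?_)
    exact Real.continuous_arctan.comp (continuous_id.div_const _)
  have hpos : 0 < Real.pi / τ := div_pos Real.pi_pos hτ
  have h0 : f 0 = 0 := by simp [hf]
  have h1 : Real.pi < f (Real.pi / τ) := by
    simp only [hf]
    rw [div_mul_cancel₀ _ hτ.ne']
    have : 0 < ∑ j, Real.arctan (Real.pi / τ / μ j) := by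
      apply Finset.sum_pos
      · intro j _
        exact Real.arctan_pos.2 (div_pos hpos (hμ j))
      · exact ⟨j0, Finset.mem_univ _⟩
    linarith
  obtain ⟨ω, hω, hfω⟩ := intermediate_value_Ioo hpos.le hcont.continuousOn
    (show Real.pi ∈ Set.Ioo (f 0) (f (Real.pi / τ)) from ⟨by rw [h0]; exact Real.pi_pos, h1⟩)
  refine ⟨ω, ⟨hω, ?_⟩, ?_⟩
  · simp only [hf] at hfω
    linarith
  · rintro y ⟨_, hy⟩
    apply hmono.injective
    rw [hfω]
    simp only [hf]
    linarith

lemma aux_bdd (N : ℕ) (τ M : ℝ) (μ : Fin N → ℝ) (hτ : 0 < τ) (hμ : ∀ j, 0 < μ j)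
    (hM : ∀ j, μ j ≤ M) (hM0 : 0 < M) :
    BddAbove {K : ℝ | 0 ≤ K ∧
            ∃ x : ℝ, (∏ j, (x + μ j)) + K * Real.exp (-x * τ) = 0} := by
  refine ⟨N.factorial * Real.exp (M * τ) / τ ^ N, ?_⟩
  rintro K ⟨hK, x, hx⟩
  have hE := Real.exp_pos (-x * τ)
  have hx0 : x < 0 := by
    by_contra h
    push Not at h
    have : 0 < ∏ j, (x + μ j) := Finset.prod_pos fun j _ => by linarith [hμ j]
    have := mul_nonneg hK hE.le
    linarith
  have h1 : |∏ j, (x + μ j)| ≤ (M - x) ^ N := by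
    rw [Finset.abs_prod]
    calc ∏ j, |x + μ j| ≤ ∏ _j : Fin N, (M - x) := by
          apply Finset.prod_le_prod
          · intro j _; exact abs_nonneg _
          · intro j _
            rw [abs_le]
            constructor <;> linarith [hμ j, hM j]
      _ = _ := by simp
  have h2 := Real.pow_div_factorial_le_exp ((M - x) * τ) (by nlinarith) N
  have h3 : K * Real.exp (-x * τ) ≤ (M - x) ^ N := by
    have := neg_abs_le (∏ j, (x + μ j))
    linarith
  rw [show (M - x) * τ = M * τ + -x * τ by ring, Real.exp_add,
    show M * τ + -x * τ = (M - x) * τ by ring, mul_pow,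
    div_le_iff₀ (by positivity)] at h2
  rw [le_div_iff₀ (by positivity)]
  have h4 : K * Real.exp (-x * τ) * τ ^ N ≤ (M - x) ^ N * τ ^ N :=
    mul_le_mul_of_nonneg_right h3 (by positivity)
  refine le_of_mul_le_mul_right ?_ hE
  linarith

/-- For every `N ≥ 3` there exist `τ > 0` and `μ₁,…,μ_N > 0` such that the stability
border is strictly smaller than the oscillation border: with `ω₁` the unique number in
`(0, π/τ)` satisfying `π − ω₁τ = Σ_j arctan(ω₁/μ_j)`, one has
`∏_j √(ω₁² + μ_j²) < sup{K ≥ 0 : ∃ x ∈ ℝ, ∏_j (x+μ_j) + K·e^{−xτ} = 0}`. -/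
theorem stmt_17 (N : ℕ) (hN : 3 ≤ N) :
    ∃ (τ : ℝ) (μ : Fin N → ℝ), 0 < τ ∧ (∀ j, 0 < μ j) ∧
      (∃! ω₁ : ℝ, ω₁ ∈ Set.Ioo 0 (Real.pi / τ) ∧
        Real.pi - ω₁ * τ = ∑ j, Real.arctan (ω₁ / μ j)) ∧
      ∀ ω₁ : ℝ, ω₁ ∈ Set.Ioo 0 (Real.pi / τ) →
        Real.pi - ω₁ * τ = ∑ j, Real.arctan (ω₁ / μ j) →
        (∏ j, Real.sqrt (ω₁ ^ 2 + μ j ^ 2)) <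
          sSup {K : ℝ | 0 ≤ K ∧
            ∃ x : ℝ, (∏ j, (x + μ j)) + K * Real.exp (-x * τ) = 0} := by
  obtain ⟨n, rfl⟩ : ∃ n, N = n + 3 := ⟨N - 3, by omega⟩
  have hn : (0 : ℝ) ≤ n := Nat.cast_nonneg n
  obtain ⟨M, hM⟩ : ∃ M : ℝ, M = 10 + 12 * ((n : ℝ) + 1) := ⟨_, rfl⟩
  have hM1 : 22 ≤ M := by linarith
  set μ : Fin (n + 3) → ℝ :=
    Fin.cons 1 (Fin.cons 1 (Fin.cons 1 (fun _ : Fin n => M))) with hμd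
  have hall : ∀ j, 0 < μ j ∧ μ j ≤ M := by
    intro j
    refine Fin.cases ?_ (fun j => Fin.cases ?_ (fun j => Fin.cases ?_ (fun j => ?_) j) j) j <;>
    · simp only [hμd, Fin.cons_zero, Fin.cons_succ]
      constructor <;> linarith
  have hμ : ∀ j, 0 < μ j := fun j => (hall j).1
  have hprod : ∀ g : ℝ → ℝ, ∏ j, g (μ j) = g 1 ^ 3 * g M ^ n := by
    intro g
    simp only [hμd, Fin.prod_univ_succ, Fin.cons_zero, Fin.cons_succ, Finset.prod_const,
      Finset.card_univ, Fintype.card_fin]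
    ring
  have hsum : ∀ g : ℝ → ℝ, ∑ j, g (μ j) = 3 * g 1 + n * g M := by
    intro g
    simp only [hμd, Fin.sum_univ_succ, Fin.cons_zero, Fin.cons_succ, Finset.sum_const,
      Finset.card_univ, Fintype.card_fin, nsmul_eq_mul]
    ring
  refine ⟨1 / 10, μ, by norm_num, hμ, aux_unique _ _ μ (by norm_num) hμ 0, ?_⟩
  rintro ω ⟨hω0, -⟩ hω
  rw [hsum (fun m => Real.arctan (ω / m))] at hω
  rw [hprod (fun m => Real.sqrt (ω ^ 2 + m ^ 2))]
  simp only [div_one] at hω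
  have hωlt : ω < Real.sqrt 3 := by
    have h1 : 0 ≤ (n : ℝ) * Real.arctan (ω / M) :=
      mul_nonneg hn (Real.arctan_nonneg.2 (by positivity))
    rw [← Real.arctan_strictMono.lt_iff_lt, Real.arctan_sqrt_three]
    linarith
  have hωsq : ω ^ 2 ≤ 3 := by
    have := Real.sq_sqrt (show (0 : ℝ) ≤ 3 by norm_num)
    nlinarith
  have hs1 : Real.sqrt (ω ^ 2 + 1 ^ 2) ≤ 2 := Real.sqrt_le_iff.2 ⟨by norm_num, by linarith⟩
  have hsM : Real.sqrt (ω ^ 2 + M ^ 2) ≤ M + 2 :=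
    Real.sqrt_le_iff.2 ⟨by linarith, by nlinarith⟩
  have hup : Real.sqrt (ω ^ 2 + 1 ^ 2) ^ 3 * Real.sqrt (ω ^ 2 + M ^ 2) ^ n
      ≤ 2 ^ 3 * (M + 2) ^ n := by gcongr
  have hMexp : M + 2 ≤ (M - 10) * Real.exp (1 / ((n : ℝ) + 1)) := by
    have h1 := Real.add_one_le_exp (1 / ((n : ℝ) + 1))
    have h2 : M + 2 = (M - 10) * (1 / ((n : ℝ) + 1) + 1) := by
      rw [hM]; field_simp; ring
    rw [h2]
    exact mul_le_mul_of_nonneg_left h1 (by linarith)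
  have hpow : (M + 2) ^ n ≤ (M - 10) ^ n * Real.exp 1 := by
    calc (M + 2) ^ n ≤ ((M - 10) * Real.exp (1 / ((n : ℝ) + 1))) ^ n := by
          gcongr
      _ = (M - 10) ^ n * Real.exp (n * (1 / ((n : ℝ) + 1))) := by
          rw [mul_pow, ← Real.exp_nat_mul]
      _ ≤ _ := by
          apply mul_le_mul_of_nonneg_left _ (pow_nonneg (by linarith) _)
          apply Real.exp_le_exp.2
          rw [mul_one_div, div_le_one (by positivity)]
          linarith
  have hP : 0 < (M - 10) ^ n := pow_pos (by linarith) _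
  have he : Real.exp 1 < 3 := Real.exp_one_lt_three
  have he0 := Real.exp_pos 1
  have hlow : 729 * (M - 10) ^ n / Real.exp 1 ∈ {K : ℝ | 0 ≤ K ∧
            ∃ x : ℝ, (∏ j, (x + μ j)) + K * Real.exp (-x * (1 / 10)) = 0} := by
    refine ⟨by positivity, -10, ?_⟩
    rw [hprod (fun m => -10 + m), show (-(-10) * (1 / 10) : ℝ) = 1 by norm_num,
      div_mul_cancel₀ _ he0.ne', show (-10 + M) = M - 10 by ring]
    ring
  refine lt_of_lt_of_le ?_ (le_csSup
    (aux_bdd _ _ M μ (by norm_num) hμ (fun j => (hall j).2) (by linarith)) hlow)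
  rw [lt_div_iff₀ he0]
  calc _ ≤ (2 ^ 3 * ((M - 10) ^ n * Real.exp 1)) * Real.exp 1 := by
        apply mul_le_mul_of_nonneg_right _ he0.le
        linarith
    _ = (M - 10) ^ n * (8 * (Real.exp 1 * Real.exp 1)) := by ring
    _ < (M - 10) ^ n * 729 := by
        apply mul_lt_mul_of_pos_left _ hP
        nlinarith
    _ = _ := by ring
end
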